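/- arXiv:2207.12584 — 4 statements merged into one kernel-verified Lean document; each statement's English description precedes it below -/
import Mathlib

section
/- Suppose |E(F_q)| ≥ q+4, n ≥ q+3 and 2 ≤ k ≤ n−2, and let C be either the residue elliptic code C_Ω(D,kO) or the functional elliptic code C_L(D,kO). Then the minimum distance of C equals n−dim(C). If moreover every F_q-linear code of length n−1 and dimension dim(C) has minimum distance at most (n−1)−dim(C) (i.e., the MDS conjecture holds for [n−1, dim(C)]-codes over F_q), then the covering radius of C equals n−dim(C)−1. -/
open Matrix BigOperators

/-- Values of the `k` monomials `x^i y^j` (`j ∈ {0,1}`, `2i+3j ≤ k`), a basis of the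
Riemann–Roch space `L(kO)`, at an affine point `P = (α, β)`:
`(1, α, …, α^⌊k/2⌋, β, αβ, …, α^⌊(k−3)/2⌋ β)`. -/
def phiAff {F : Type*} [Field F] (k : ℕ) (P : F × F) : Fin k → F :=
  fun j => if (j : ℕ) ≤ k / 2 then P.1 ^ (j : ℕ) else P.2 * P.1 ^ ((j : ℕ) - k / 2 - 1)

/-- The vector `φ_k(O)` attached to the point at infinity: the standard unit vector supported
at the coordinate of `x^{k/2}` (`k` even) resp. `x^{(k-3)/2} y` (`k` odd). -/
def phiInf (F : Type*) [Field F] (k : ℕ) : Fin k → F :=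
  fun j => if (j : ℕ) = (if k % 2 = 0 then k / 2 else k - 1) then 1 else 0

/-- The parity-check matrix `H(k)` with columns `φ_k(P_1), …, φ_k(P_n)`. -/
def Hmat {F : Type*} [Field F] {n : ℕ} (k : ℕ) (P : Fin n → F × F) :
    Matrix (Fin k) (Fin n) F := fun i j => phiAff k (P j) i

/-- The functional elliptic code `C_L(D, kO)`: the row space of `H(k)`. -/
def funcCode {F : Type*} [Field F] {n : ℕ} (k : ℕ) (P : Fin n → F × F) :
    Set (Fin n → F) := {v | ∃ u : Fin k → F, v = Matrix.vecMul u (Hmat k P)}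

/-- The residue elliptic code `C_Ω(D, kO) = {v : H(k) vᵀ = 0}`. -/
def resCode {F : Type*} [Field F] {n : ℕ} (k : ℕ) (P : Fin n → F × F) :
    Set (Fin n → F) := {v | Matrix.mulVec (Hmat k P) v = 0}

/-- Error distance `d(v, C)` from a word to a code. -/
noncomputable def dTo {F : Type*} [DecidableEq F] {n : ℕ} (v : Fin n → F) (C : Set (Fin n → F)) : ℕ :=
  sInf (hammingDist v '' C)

/-- Covering radius `ρ(C) = max_v d(v, C)`. -/
noncomputable def covRad {F : Type*} [DecidableEq F] {n : ℕ} (C : Set (Fin n → F)) : ℕ :=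
  sSup (Set.range fun v : Fin n → F => dTo v C)

/-- Minimum distance: the least Hamming weight of a nonzero codeword. -/
noncomputable def minDist {F : Type*} [DecidableEq F] [Zero F] {n : ℕ} (C : Set (Fin n → F)) : ℕ :=
  sInf ((fun c => hammingDist c 0) '' (C \ {0}))

/-- Dimension of a code (as the dimension of its linear span). -/
noncomputable def dimCode (F : Type*) [Field F] {n : ℕ} (C : Set (Fin n → F)) : ℕ :=
  Module.finrank F (Submodule.span F C)

/-- `(α, β)` is an affine rational point of the curve `y² = x³ + s x + t`. -/
def onCurve {F : Type*} [Field F] (s t : F) (P : F × F) : Prop :=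
  P.2 ^ 2 = P.1 ^ 3 + s * P.1 + t

/-- The number `|E(F_q)|` of rational points: affine points plus the point at infinity. -/
def numPoints (F : Type*) [Field F] [Fintype F] [DecidableEq F] (s t : F) : ℕ :=
  (Finset.univ.filter (fun P : F × F => P.2 ^ 2 = P.1 ^ 3 + s * P.1 + t)).card + 1

section Combinatorics

variable {G : Type*} [AddCommGroup G] [DecidableEq G]

/-- `A` contains two distinct elements with sum `c`. -/
def HasPair (c : G) (A : Finset G) : Prop := ∃ a ∈ A, ∃ b ∈ A, a ≠ b ∧ a + b = c

/-- The elements of `D` which have a distinct partner in `D` with sum `c`. -/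
def partners (D : Finset G) (c : G) : Finset G := {x ∈ D | c - x ∈ D ∧ x + x ≠ c}

lemma exists_pair_of_card {D : Finset G} {c : G} (E : Finset G)
    (h : E.card < (partners D c).card) :
    ∃ x ∈ D, c - x ∈ D ∧ x ≠ c - x ∧ x ∉ E := by
  obtain ⟨x, hx, hxE⟩ := Finset.exists_mem_notMem_of_card_lt_card h
  simp only [partners, Finset.mem_filter] at hx
  refine ⟨x, hx.1, hx.2.1, fun h => hx.2.2 ?_, hxE⟩
  nth_rewrite 2 [h]
  abel

lemma hasPair_and_hasPair_sdiff {B D : Finset G} {c x y x' y' : G} (hx : x ∈ D) (hy : y ∈ D)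
    (hx' : x' ∈ D) (hy' : y' ∈ D) (hxy : x ≠ y) (hxy' : x' ≠ y') (hc : x + y = c)
    (hc' : x' + y' = c) (h : y ∈ B ↔ x ∈ B) (h' : y' ∈ B ↔ x' ∈ B) (h'' : x ∈ B ↔ x' ∉ B) :
    HasPair c B ∧ HasPair c (D \ B) := by
  have sd : ∀ z ∈ D, z ∉ B → z ∈ D \ B := fun z h1 h2 => Finset.mem_sdiff.2 ⟨h1, h2⟩
  by_cases hB : x ∈ B
  · have hB' := h''.1 hB
    exact ⟨⟨x, hB, y, h.2 hB, hxy, hc⟩,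
      ⟨x', sd _ hx' hB', y', sd _ hy' (fun k => hB' (h'.1 k)), hxy', hc'⟩⟩
  · have hB' : x' ∈ B := by_contra fun k => hB (h''.2 k)
    exact ⟨⟨x', hB', y', h'.2 hB', hxy', hc'⟩,
      ⟨x, sd _ hx hB, y, sd _ hy (fun k => hB (h.1 k)), hxy, hc⟩⟩

set_option maxHeartbeats 1000000 in
open Classical in
lemma card_no_pair_lt_card_two_pairs {D : Finset G} {c : G} {k : ℕ}
    (hk : 3 ≤ k) (hkD : k + 3 ≤ D.card) (hc : 5 ≤ (partners D c).card) :
    ({A ∈ D.powersetCard k | ¬ HasPair c A ∧ ¬ HasPair c (D \ A)} : Finset (Finset G)).card <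
      ({A ∈ D.powersetCard k | HasPair c A ∧ HasPair c (D \ A)} : Finset (Finset G)).card := by
  obtain ⟨x₁, hx₁, hy₁, h₁, -⟩ := exists_pair_of_card (D := D) (c := c) ∅
    (by rw [Finset.card_empty]; omega)
  obtain ⟨x₂, hx₂, hy₂, h₂, hE₂⟩ := exists_pair_of_card (D := D) (c := c) {x₁, c - x₁}
    (Finset.card_le_two.trans_lt (by omega))
  obtain ⟨x₃, hx₃, hy₃, h₃, hE₃⟩ := exists_pair_of_card (D := D) (c := c)
    {x₁, c - x₁, x₂, c - x₂} (Finset.card_le_four.trans_lt (by omega))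
  have e₁ : x₁ + (c - x₁) = c := by abel
  have e₂ : x₂ + (c - x₂) = c := by abel
  have e₃ : x₃ + (c - x₃) = c := by abel
  have n₁ : c - x₁ ≠ c - x₂ := by
    intro h; exact hE₂ (by rw [sub_right_inj] at h; simp [h])
  have n₂ : c - x₁ ≠ c - x₃ := by
    intro h; exact hE₃ (by rw [sub_right_inj] at h; simp [h])
  have n₃ : c - x₂ ≠ c - x₃ := by
    intro h; exact hE₃ (by rw [sub_right_inj] at h; simp [h])
  have n₄ : x₁ ≠ c - x₂ := by rintro h; apply hE₂; simp [h]
  have n₅ : x₁ ≠ c - x₃ := by rintro h; apply hE₃; simp [h]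
  have n₆ : x₂ ≠ c - x₃ := by rintro h; apply hE₃; simp [h]
  generalize c - x₁ = y₁ at *
  generalize c - x₂ = y₂ at *
  generalize c - x₃ = y₃ at *
  simp only [Finset.mem_insert, Finset.mem_singleton, not_or] at hE₂ hE₃
  set Z : Finset (Finset G) := {A ∈ D.powersetCard k | ¬ HasPair c A ∧ ¬ HasPair c (D \ A)} with hZ
  set W : Finset (Finset G) := {A ∈ D.powersetCard k | HasPair c A ∧ HasPair c (D \ A)} with hW
  let φ : Finset G → Finset G := fun A =>
    if x₁ ∈ A ↔ x₂ ∈ A then A.map (Equiv.swap y₁ x₂).toEmbedding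
    else if x₂ ∈ A ↔ x₃ ∈ A then A.map (Equiv.swap y₂ x₃).toEmbedding
    else A.map (Equiv.swap y₁ x₃).toEmbedding
  have mem_map : ∀ (A : Finset G) (a b z : G),
      z ∈ A.map (Equiv.swap a b).toEmbedding ↔ Equiv.swap a b z ∈ A := by
    intro A a b z
    rw [Finset.mem_map_equiv, Equiv.symm_swap]
  have hmixed : ∀ A ∈ Z, (y₁ ∈ A ↔ x₁ ∉ A) ∧ (y₂ ∈ A ↔ x₂ ∉ A) ∧ (y₃ ∈ A ↔ x₃ ∉ A) := by
    intro A hA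
    simp only [hZ, Finset.mem_filter, HasPair, Finset.mem_sdiff] at hA
    obtain ⟨-, hA, hB⟩ := hA
    push Not at hA hB
    refine ⟨?_, ?_, ?_⟩ <;> grind
  have hbranch : ∀ A ∈ Z, φ A ∈ D.powersetCard k ∧
      (((x₁ ∈ A ↔ x₂ ∈ A) ∧ φ A = A.map (Equiv.swap y₁ x₂).toEmbedding ∧
        (y₁ ∈ φ A ↔ x₁ ∈ φ A) ∧ (y₂ ∈ φ A ↔ x₂ ∈ φ A) ∧ (x₁ ∈ φ A ↔ x₂ ∉ φ A) ∧
        (y₃ ∈ φ A ↔ x₃ ∉ φ A)) ∨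
      ((x₂ ∈ A ↔ x₃ ∈ A) ∧ φ A = A.map (Equiv.swap y₂ x₃).toEmbedding ∧
        (y₂ ∈ φ A ↔ x₂ ∈ φ A) ∧ (y₃ ∈ φ A ↔ x₃ ∈ φ A) ∧ (x₂ ∈ φ A ↔ x₃ ∉ φ A) ∧
        (y₁ ∈ φ A ↔ x₁ ∉ φ A) ∧ (x₁ ∈ φ A ↔ x₂ ∉ φ A)) ∨
      ((x₁ ∈ A ↔ x₃ ∈ A) ∧ φ A = A.map (Equiv.swap y₁ x₃).toEmbedding ∧
        (y₁ ∈ φ A ↔ x₁ ∈ φ A) ∧ (y₃ ∈ φ A ↔ x₃ ∈ φ A) ∧ (x₁ ∈ φ A ↔ x₃ ∉ φ A) ∧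
        (y₂ ∈ φ A ↔ x₂ ∉ φ A))) := by
    intro A hA
    obtain ⟨m₁, m₂, m₃⟩ := hmixed A hA
    have hAD := (Finset.mem_filter.1 hA).1
    rw [Finset.mem_powersetCard] at hAD
    have hpow : ∀ a ∈ D, ∀ b ∈ D, A.map (Equiv.swap a b).toEmbedding ∈ D.powersetCard k := by
      intro a ha b hb
      rw [Finset.mem_powersetCard, Finset.card_map]
      refine ⟨fun z hz => ?_, hAD.2⟩
      rw [mem_map, Equiv.swap_apply_def] at hz
      split_ifs at hz with h1 h2
      · rwa [h1]
      · rwa [h2]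
      · exact hAD.1 hz
    by_cases c₁ : (x₁ ∈ A ↔ x₂ ∈ A)
    · have hφA : φ A = A.map (Equiv.swap y₁ x₂).toEmbedding := if_pos c₁
      rw [hφA]
      refine ⟨hpow _ hy₁ _ hx₂, Or.inl ⟨c₁, rfl, ?_⟩⟩
      simp only [mem_map, Equiv.swap_apply_def]
      grind
    · by_cases c₂ : (x₂ ∈ A ↔ x₃ ∈ A)
      · have hφA : φ A = A.map (Equiv.swap y₂ x₃).toEmbedding := by
          simp only [φ, if_neg c₁, if_pos c₂]
        rw [hφA]
        refine ⟨hpow _ hy₂ _ hx₃, Or.inr (Or.inl ⟨c₂, rfl, ?_⟩)⟩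
        simp only [mem_map, Equiv.swap_apply_def]
        grind
      · have hφA : φ A = A.map (Equiv.swap y₁ x₃).toEmbedding := by
          simp only [φ, if_neg c₁, if_neg c₂]
        rw [hφA]
        refine ⟨hpow _ hy₁ _ hx₃, Or.inr (Or.inr ⟨by tauto, rfl, ?_⟩)⟩
        simp only [mem_map, Equiv.swap_apply_def]
        grind
  have hφ : ∀ A ∈ Z, φ A ∈ W ∧ ¬ (x₂ ∈ φ A ∧ y₂ ∈ φ A ∧ x₁ ∈ φ A ∧
      x₃ ∉ φ A ∧ y₃ ∉ φ A ∧ y₁ ∉ φ A) := by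
    intro A hA
    obtain ⟨hp, h⟩ := hbranch A hA
    refine ⟨?_, ?_⟩
    swap
    · rintro ⟨b₁, b₂, b₃, b₄, b₅, b₆⟩
      rcases h with ⟨-, -, h, -⟩ | ⟨-, -, -, -, -, -, h⟩ | ⟨-, -, h, -⟩
      · exact b₆ (h.2 b₃)
      · exact h.1 b₃ b₁
      · exact b₆ (h.2 b₃)
    refine Finset.mem_filter.2 ⟨hp, ?_⟩
    rcases h with ⟨-, -, h⟩ | ⟨-, -, h⟩ | ⟨-, -, h⟩
    · exact hasPair_and_hasPair_sdiff hx₁ hy₁ hx₂ hy₂ h₁ h₂ e₁ e₂ h.1 h.2.1 h.2.2.1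
    · exact hasPair_and_hasPair_sdiff hx₂ hy₂ hx₃ hy₃ h₂ h₃ e₂ e₃ h.1 h.2.1 h.2.2.1
    · exact hasPair_and_hasPair_sdiff hx₁ hy₁ hx₃ hy₃ h₁ h₃ e₁ e₃ h.1 h.2.1 h.2.2.1
  have hinj : Set.InjOn φ Z := by
    intro A hA B hB hAB
    obtain ⟨-, h⟩ := hbranch A hA
    obtain ⟨-, h'⟩ := hbranch B hB
    rw [← hAB] at h'
    rcases h with ⟨-, e, h⟩ | ⟨-, e, h⟩ | ⟨-, e, h⟩ <;>
    rcases h' with ⟨-, e', h'⟩ | ⟨-, e', h'⟩ | ⟨-, e', h'⟩ <;>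
    first
    | exact Finset.map_injective _ (e.symm.trans e')
    | (exfalso; clear e e' hAB; grind)
  obtain ⟨A₀, hA₀, hA₀'⟩ : ∃ A ∈ D.powersetCard k, (x₂ ∈ A ∧ y₂ ∈ A ∧ x₁ ∈ A ∧
      x₃ ∉ A ∧ y₃ ∉ A ∧ y₁ ∉ A) := by
    have h3 : ({x₂, y₂, x₁} : Finset G).card = 3 := by
      rw [Finset.card_eq_three]
      exact ⟨_, _, _, h₂, hE₂.1, n₄.symm, rfl⟩
    have h3' : ({x₃, y₃, y₁} : Finset G).card = 3 := by
      rw [Finset.card_eq_three]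
      exact ⟨_, _, _, h₃, by grind, n₂.symm, rfl⟩
    obtain ⟨A, hA1, hA2, hA3⟩ := Finset.exists_subsuperset_card_eq
      (s := {x₂, y₂, x₁}) (t := D \ {x₃, y₃, y₁}) (n := k) (by grind) (by omega) (by
        rw [Finset.card_sdiff_of_subset (by grind)]; omega)
    refine ⟨A, Finset.mem_powersetCard.2 ⟨by grind, hA3⟩, by grind⟩
  have hA₀W : A₀ ∈ W := by
    simp only [hW, Finset.mem_filter]
    refine ⟨hA₀, ⟨x₂, hA₀'.1, y₂, hA₀'.2.1, h₂, e₂⟩, ⟨x₃, ?_, y₃, ?_, h₃, e₃⟩⟩ <;> grind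
  calc Z.card = (Z.image φ).card := (Finset.card_image_of_injOn hinj).symm
    _ < W.card := Finset.card_lt_card (by
      rw [Finset.ssubset_iff_of_subset]
      · refine ⟨A₀, hA₀W, fun h => ?_⟩
        obtain ⟨A, hA, rfl⟩ := Finset.mem_image.1 h
        exact (hφ A hA).2 hA₀'
      · intro B hB
        obtain ⟨A, hA, rfl⟩ := Finset.mem_image.1 hB
        exact (hφ A hA).1)

/-- `D` has a subset of size `k` with sum `T`. -/
def HasSubsetSum (D : Finset G) (k : ℕ) (T : G) : Prop := ∃ A ⊆ D, A.card = k ∧ ∑ a ∈ A, a = T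

lemma hasSubsetSum_of_hasPair {D A : Finset G} {T c c' : G} (hA : A ⊆ D) (h : HasPair c A)
    (h' : HasPair c' (D \ A)) (hT : ∑ a ∈ A, a - c + c' = T) : HasSubsetSum D A.card T := by
  obtain ⟨a, ha, b, hb, hab, rfl⟩ := h
  obtain ⟨a', ha', b', hb', hab', rfl⟩ := h'
  rw [Finset.mem_sdiff] at ha' hb'
  have hd : Disjoint (A \ {a, b}) {a', b'} := by
    rw [Finset.disjoint_left]; grind
  have hsub : ({a, b} : Finset G) ⊆ A := by grind
  refine ⟨(A \ {a, b}) ∪ {a', b'}, by grind, ?_, ?_⟩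
  · have := Finset.card_le_card hsub
    rw [Finset.card_union_of_disjoint hd, Finset.card_sdiff_of_subset hsub]
    rw [Finset.card_pair hab] at *
    rw [Finset.card_pair hab']
    omega
  · rw [Finset.sum_union hd, Finset.sum_pair hab', ← hT]
    have := Finset.sum_sdiff (f := fun x => x) hsub
    rw [Finset.sum_pair hab] at this
    rw [← this]
    abel

open Classical in
theorem hasSubsetSum_of_five_le_card_partners [Fintype G] {D : Finset G} {k : ℕ}
    (hk : 3 ≤ k) (hkD : k + 3 ≤ D.card) (hD : ∀ c, 5 ≤ (partners D c).card) (T : G) :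
    HasSubsetSum D k T := by
  by_contra hT
  have hle : ∀ A ∈ D.powersetCard k,
      (∑ c : G, ((if HasPair c A then 1 else 0) + (if HasPair c (D \ A) then 1 else 0))) ≤
        Fintype.card G := by
    intro A hA
    rw [Finset.mem_powersetCard] at hA
    have hshift := Equiv.sum_comp (Equiv.addRight (T - ∑ a ∈ A, a))
      (fun c => if HasPair c (D \ A) then 1 else 0)
    rw [Finset.sum_add_distrib, ← hshift, ← Finset.sum_add_distrib,
      ← Finset.card_univ, Finset.card_eq_sum_ones]
    refine Finset.sum_le_sum fun c _ => ?_
    by_cases h1 : HasPair c A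
    · have h2 : ¬ HasPair (Equiv.addRight (T - ∑ a ∈ A, a) c) (D \ A) := by
        intro h2
        refine hT (hA.2 ▸ hasSubsetSum_of_hasPair hA.1 h1 h2 ?_)
        rw [Equiv.coe_addRight, ← add_assoc, sub_add_cancel, add_sub_cancel]
      rw [if_pos h1, if_neg h2]
    · simp only [h1, if_false, zero_add]
      split_ifs <;> simp
  have hlt : ∀ c : G, (D.powersetCard k).card <
      ∑ A ∈ D.powersetCard k,
        ((if HasPair c A then 1 else 0) + (if HasPair c (D \ A) then 1 else 0)) := by
    intro c
    have h := card_no_pair_lt_card_two_pairs hk hkD (hD c)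
    rw [Finset.card_filter, Finset.card_filter] at h
    have : (D.powersetCard k).card + ∑ A ∈ D.powersetCard k,
        (if HasPair c A ∧ HasPair c (D \ A) then 1 else 0) =
        ∑ A ∈ D.powersetCard k,
          ((if HasPair c A then 1 else 0) + (if HasPair c (D \ A) then 1 else 0)) +
        ∑ A ∈ D.powersetCard k, (if ¬ HasPair c A ∧ ¬ HasPair c (D \ A) then 1 else 0) := by
      rw [Finset.card_eq_sum_ones, ← Finset.sum_add_distrib, ← Finset.sum_add_distrib]
      refine Finset.sum_congr rfl fun A _ => ?_
      by_cases h1 : HasPair c A <;> by_cases h2 : HasPair c (D \ A) <;> simp [h1, h2]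
    omega
  have h1 := Finset.sum_le_sum hle
  have h2 := Finset.sum_lt_sum_of_nonempty (Finset.univ_nonempty (α := G)) fun c _ => hlt c
  rw [Finset.sum_comm] at h2
  simp only [Finset.sum_const, smul_eq_mul, Finset.card_univ] at h1 h2
  rw [mul_comm] at h2
  omega

lemma hasSubsetSum_add_two {D A E : Finset G} {c : G} (hA : A ⊆ D)
    (hE : ∀ a ∈ A, a ∈ E ∧ c - a ∈ E) (h : E.card < (partners D c).card) :
    HasSubsetSum D (A.card + 2) (∑ a ∈ A, a + c) := by
  obtain ⟨x, hx, hcx, hne, hxE⟩ := exists_pair_of_card E h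
  have hxA : x ∉ A := fun h => hxE (hE x h).1
  have hcA : c - x ∉ A := fun h => hxE (by simpa using (hE _ h).2)
  have hd : Disjoint A {x, c - x} := by
    rw [Finset.disjoint_left]; grind
  refine ⟨A ∪ {x, c - x}, by grind, ?_, ?_⟩
  · rw [Finset.card_union_of_disjoint hd, Finset.card_pair hne]
  · rw [Finset.sum_union hd, Finset.sum_pair hne, add_sub_cancel]

lemma HasSubsetSum.compl {D : Finset G} {k : ℕ} (h : HasSubsetSum D k (∑ a ∈ D, a)) :
    HasSubsetSum D (D.card - k) 0 := by
  obtain ⟨A, hA, rfl, hs⟩ := h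
  refine ⟨D \ A, Finset.sdiff_subset, Finset.card_sdiff_of_subset hA, ?_⟩
  have := Finset.sum_sdiff (f := fun x => x) hA
  rw [hs] at this
  simpa using this

lemma hasSubsetSum_six_zero {D : Finset G} (h : 5 ≤ (partners D 0).card) :
    HasSubsetSum D 6 0 := by
  obtain ⟨x, hx, hcx, hne, -⟩ := exists_pair_of_card (D := D) (c := 0) ∅
    (by rw [Finset.card_empty]; omega)
  obtain ⟨y, hy, hcy, hney, hyE⟩ := exists_pair_of_card (D := D) (c := 0) {x, 0 - x}
    (Finset.card_le_two.trans_lt (by omega))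
  have hyx : 0 - y ≠ x := by rintro rfl; simp at hyE
  have hyx' : 0 - y ≠ 0 - x := by
    intro h; rw [sub_right_inj] at h; simp [h] at hyE
  simp only [Finset.mem_insert, Finset.mem_singleton, not_or] at hyE
  have h1 : x ∉ ({0 - x, y, 0 - y} : Finset G) := by
    simp only [Finset.mem_insert, Finset.mem_singleton, not_or]
    exact ⟨hne, Ne.symm hyE.1, hyx.symm⟩
  have h2 : 0 - x ∉ ({y, 0 - y} : Finset G) := by
    simp only [Finset.mem_insert, Finset.mem_singleton, not_or]
    exact ⟨Ne.symm hyE.2, hyx'.symm⟩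
  have := hasSubsetSum_add_two (D := D) (A := {x, 0 - x, y, 0 - y})
    (E := {x, 0 - x, y, 0 - y}) (c := 0) (by grind) (by simp)
    (Finset.card_le_four.trans_lt (by omega))
  rw [Finset.card_insert_of_notMem h1, Finset.card_insert_of_notMem h2, Finset.card_pair hney,
    Finset.sum_insert h1, Finset.sum_insert h2, Finset.sum_pair hney] at this
  simpa using this

lemma hasSubsetSum_two {D : Finset G} {T : G} (h : 0 < (partners D T).card) :
    HasSubsetSum D 2 T := by
  simpa using hasSubsetSum_add_two (D := D) (A := ∅) (E := ∅) (c := T) (by simp) (by simp)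
    (by rwa [Finset.card_empty])

variable [Fintype G]

lemma two_mul_card_le (D : Finset G) (c : G) :
    2 * D.card ≤ (partners D c).card + ({x ∈ D | x + x = c} : Finset G).card +
      ({x | x ∈ D ∨ c - x ∈ D} : Finset G).card := by
  have h1 : ({x | c - x ∈ D} : Finset G).card = D.card := by
    refine Finset.card_bij (fun x _ => c - x) (by simp) (by simp) fun b hb => ⟨c - b, by simpa, by simp⟩
  have h2 := Finset.card_union_add_card_inter D ({x | c - x ∈ D} : Finset G)
  have h3 : (D ∩ ({x | c - x ∈ D} : Finset G)).card ≤
      (partners D c).card + ({x ∈ D | x + x = c} : Finset G).card := by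
    refine (Finset.card_le_card ?_).trans (Finset.card_union_le _ _)
    intro x
    simp only [partners, Finset.mem_inter, Finset.mem_union, Finset.mem_filter, Finset.mem_univ]
    tauto
  have h4 : D ∪ ({x | c - x ∈ D} : Finset G) = ({x | x ∈ D ∨ c - x ∈ D} : Finset G) := by
    ext; simp
  rw [h4] at h2
  omega

lemma card_add_self_eq_le (c : G) :
    ({x : G | x + x = c} : Finset G).card ≤ ({x : G | x + x = 0} : Finset G).card := by
  rcases ({x : G | x + x = c} : Finset G).eq_empty_or_nonempty with h | ⟨a, ha⟩
  · simp [h]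
  · refine Finset.card_le_card_of_injOn (fun x => x - a) (fun x hx => ?_) (by simp)
    simp only [Finset.mem_coe, Finset.mem_filter, Finset.mem_univ, true_and] at ha hx ⊢
    rw [sub_add_sub_comm, hx, ha, sub_self]

lemma two_mul_card_le_partners (D : Finset G) (c : G) :
    2 * D.card ≤ (partners D c).card + ({x : G | x + x = 0} : Finset G).card +
      Fintype.card G := by
  have h1 := two_mul_card_le D c
  have h2 := card_add_self_eq_le c
  have h3 : ({x ∈ D | x + x = c} : Finset G).card ≤ ({x : G | x + x = c} : Finset G).card :=
    Finset.card_le_card fun x => by simp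
  have h4 := Finset.card_le_univ ({x | x ∈ D ∨ c - x ∈ D} : Finset G)
  omega

lemma two_mul_card_le_partners_of_not_double (D : Finset G) {c : G} (hc : ∀ x, x + x ≠ c) :
    2 * D.card ≤ (partners D c).card + Fintype.card G := by
  have h1 := two_mul_card_le D c
  have h3 : ({x ∈ D | x + x = c} : Finset G) = ∅ := by simp [hc]
  have h4 := Finset.card_le_univ ({x | x ∈ D ∨ c - x ∈ D} : Finset G)
  rw [h3, Finset.card_empty] at h1
  omega

lemma two_mul_card_le_partners_zero {D : Finset G} (hD : 0 ∉ D) :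
    2 * D.card + 2 ≤ (partners D 0).card + ({x : G | x + x = 0} : Finset G).card +
      Fintype.card G := by
  have h1 := two_mul_card_le D 0
  have h3 : ({x ∈ D | x + x = 0} : Finset G).card < ({x : G | x + x = 0} : Finset G).card := by
    refine Finset.card_lt_card ((Finset.ssubset_iff_of_subset fun x => by simp).2 ⟨0, by simp, ?_⟩)
    simp [hD]
  have h4 : ({x | x ∈ D ∨ 0 - x ∈ D} : Finset G).card < Fintype.card G :=
    Finset.card_lt_univ_of_notMem (x := 0) (by simpa using hD)
  omega

lemma card_doubles_mul :
    (Finset.univ.image fun x : G => x + x).card * ({x : G | x + x = 0} : Finset G).card ≤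
      Fintype.card G := by
  rw [← Finset.card_univ (α := G),
    Finset.card_eq_sum_card_image (fun x : G => x + x) Finset.univ, ← smul_eq_mul]
  refine Finset.card_nsmul_le_sum _ _ _ fun c hc => ?_
  obtain ⟨a, -, rfl⟩ := Finset.mem_image.1 hc
  refine Finset.card_le_card_of_injOn (fun x => x + a) (fun x hx => ?_) (by simp)
  simp only [Finset.coe_filter, Finset.mem_univ, true_and, Set.mem_ofPred_eq] at hx ⊢
  rw [add_add_add_comm, hx, zero_add]

lemma hasSubsetSum_small {D : Finset G} {k : ℕ}
    (hD : Fintype.card G + ({x : G | x + x = 0} : Finset G).card + 4 ≤ 2 * D.card)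
    (hτ : D.card ≤ 2 * ({x : G | x + x = 0} : Finset G).card + 4)
    (hτ' : ({x : G | x + x = 0} : Finset G).card ≠ 3)
    (hk : 3 ≤ k) (hk' : k ≤ 5) (hkD : 2 * k ≤ D.card) (T : G) : HasSubsetSum D k T := by
  have hp := two_mul_card_le_partners D
  obtain rfl | rfl | rfl : k = 3 ∨ k = 4 ∨ k = 5 := by omega
  · obtain ⟨e, he⟩ : D.Nonempty := Finset.card_pos.1 (by omega)
    have := hasSubsetSum_add_two (D := D) (A := {e}) (E := {e, T - e - e}) (c := T - e)
      (by simpa) (by simp) (Finset.card_le_two.trans_lt (by have := hp (T - e); omega))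
    simpa using this
  · by_cases hT : ∃ c, c + c = T
    · obtain ⟨c, rfl⟩ := hT
      obtain ⟨x, hx, hcx, hne, -⟩ := exists_pair_of_card (D := D) (c := c) ∅
        (by rw [Finset.card_empty]; have := hp c; omega)
      have := hasSubsetSum_add_two (D := D) (A := {x, c - x}) (E := {x, c - x}) (c := c)
        (by grind) (by simp) (Finset.card_le_two.trans_lt (by have := hp c; omega))
      rwa [Finset.card_pair hne, Finset.sum_pair hne, add_sub_cancel] at this
    · push Not at hT
      have hpT := two_mul_card_le_partners_of_not_double D hT
      obtain ⟨x, hx, hcx, hne, -⟩ := exists_pair_of_card (D := D) (c := 0) ∅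
        (by rw [Finset.card_empty]; have := hp 0; omega)
      have := hasSubsetSum_add_two (D := D) (A := {x, 0 - x})
        (E := {x, 0 - x, T - x, T - (0 - x)}) (c := T)
        (by grind) (by simp) (Finset.card_le_four.trans_lt (by omega))
      rwa [Finset.card_pair hne, Finset.sum_pair hne, add_sub_cancel, zero_add] at this
  · obtain ⟨x, hx, hcx, hne, -⟩ := exists_pair_of_card (D := D) (c := 0) ∅
      (by rw [Finset.card_empty]; have := hp 0; omega)
    have h4 : 4 ≤ ({x : G | x + x = 0} : Finset G).card := by omega
    obtain ⟨e, he, hed, heT⟩ : ∃ e ∈ D, e ∉ ({x, 0 - x} : Finset G) ∧ ∀ y, y + y ≠ T - e := by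
      by_contra! hcon
      have hsub : D \ {x, 0 - x} ⊆ (Finset.univ.image fun y : G => y + y).image (T - ·) := by
        intro e he
        rw [Finset.mem_sdiff] at he
        obtain ⟨y, hy⟩ := hcon e he.1 he.2
        rw [Finset.mem_image]
        exact ⟨y + y, Finset.mem_image_of_mem _ (Finset.mem_univ _), by simp [hy]⟩
      have h5 := (Finset.card_le_card hsub).trans Finset.card_image_le
      rw [Finset.card_sdiff_of_subset (by grind), Finset.card_pair hne] at h5
      have h6 := (Nat.mul_le_mul h5 h4).trans card_doubles_mul
      omega
    have hpT := two_mul_card_le_partners_of_not_double D heT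
    have hcard : ({x, 0 - x, e} : Finset G).card = 3 :=
      Finset.card_eq_three.2 ⟨_, _, _, hne, by grind, by grind, rfl⟩
    have hsum : ∑ a ∈ ({x, 0 - x, e} : Finset G), a = e := by
      rw [Finset.sum_insert (by grind), Finset.sum_pair (by grind)]
      abel
    have := hasSubsetSum_add_two (D := D) (A := {x, 0 - x, e})
      (E := {x, 0 - x, e, T - e - x, T - e - (0 - x), T - e - e}) (c := T - e)
      (by grind) (by simp) (Finset.card_le_six.trans_lt (by omega))
    rwa [hcard, hsum, add_sub_cancel] at this

/-- A large subset of a group with small two-torsion has zero-sum subsets of every size `k`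
with `2 ≤ k ≤ |D| - 2`. -/
theorem hasSubsetSum_zero {D : Finset G} {k : ℕ} (h0 : 0 ∉ D)
    (hD : Fintype.card G + ({x : G | x + x = 0} : Finset G).card + 4 ≤ 2 * D.card)
    (hD' : Fintype.card G + ({x : G | x + x = 0} : Finset G).card + 5 ≤ 2 * D.card ∨
      D.card ≤ 2 * ({x : G | x + x = 0} : Finset G).card + 4)
    (hτ : ({x : G | x + x = 0} : Finset G).card ≤ 4)
    (hτ' : ({x : G | x + x = 0} : Finset G).card ≠ 3)
    (hk : 2 ≤ k) (hkD : k + 2 ≤ D.card) : HasSubsetSum D k 0 := by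
  have hp := two_mul_card_le_partners D
  have hcompl : HasSubsetSum D (D.card - k) (∑ a ∈ D, a) → HasSubsetSum D k 0 := by
    intro h
    have := h.compl
    rwa [Nat.sub_sub_self (by omega)] at this
  rcases hk.eq_or_lt with rfl | hk3
  · exact hasSubsetSum_two (by have := hp 0; omega)
  rcases hkD.eq_or_lt with hkD' | hkD3
  · refine hcompl ?_
    rw [← hkD', Nat.add_sub_cancel_left]
    exact hasSubsetSum_two (by have := hp (∑ a ∈ D, a); omega)
  rcases hD' with hD' | hD'
  · exact hasSubsetSum_of_five_le_card_partners hk3 hkD3 (fun c => by have := hp c; omega) 0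
  · rcases le_or_gt (2 * k) D.card with h2 | h2
    · rcases le_or_gt k 5 with h5 | h5
      · exact hasSubsetSum_small hD hD' hτ' hk3 h5 h2 0
      · obtain rfl : k = 6 := by omega
        exact hasSubsetSum_six_zero (by have := two_mul_card_le_partners_zero h0; omega)
    · exact hcompl (hasSubsetSum_small hD hD' hτ' (by omega) (by omega) (by omega) _)

end Combinatorics

section SquareValues

open Polynomial

variable {F : Type*} [Field F] [Fintype F]

lemma X_pow_card_sub_X_dvd {P : F[X]} (hP : ∀ x, P.eval x = 0) :
    X ^ Fintype.card F - X ∣ P := by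
  classical
  have hmonic : (X ^ Fintype.card F - X : F[X]).Monic :=
    monic_X_pow_sub (degree_X_le.trans_lt (by exact_mod_cast Fintype.one_lt_card))
  have hroots := FiniteField.roots_X_pow_card_sub_X F
  have hprod : ∏ x : F, (X - C x) = X ^ Fintype.card F - X := by
    have := prod_multiset_X_sub_C_of_monic_of_roots_card_eq hmonic (by
      rw [hroots, FiniteField.X_pow_card_sub_X_natDegree_eq F Fintype.one_lt_card]
      exact Finset.card_univ)
    rw [hroots] at this
    exact this
  rw [← hprod]
  refine Finset.prod_dvd_of_coprime ?_ fun x _ => dvd_iff_isRoot.2 (hP x)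
  exact (pairwise_coprime_X_sub_C Function.injective_id).set_pairwise _

/-- A cubic taking only square values over `F_q` can only exist when `q ≤ 2 * e + 3`, where `e` is
the number of its roots in `F_q`. -/
theorem card_le_of_forall_isSquare_eval [DecidableEq F] (hq : Odd (Fintype.card F)) {f : F[X]}
    (hf : f.natDegree = 3) (hsq : ∀ x, IsSquare (f.eval x)) :
    Fintype.card F ≤ 2 * ({x | f.eval x = 0} : Finset F).card + 3 := by
  classical
  obtain ⟨m, hm⟩ := hq
  have hq1 : 1 < Fintype.card F := Fintype.one_lt_card
  have hcard : (2 * (m : F[X]) + 1) = 0 := by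
    have : ((Fintype.card F : ℕ) : F) = 0 := FiniteField.cast_card_eq_zero F
    have := congrArg (C : F → F[X]) this
    rw [hm] at this
    simpa only [Nat.cast_add, Nat.cast_mul, Nat.cast_ofNat, Nat.cast_one, map_add, map_mul,
      map_ofNat, map_natCast, map_one, map_zero] using this
  have hcard' : (Fintype.card F : F[X]) = 0 := by rw [hm]; push_cast; exact hcard
  have h2 : (2 : F[X]) ≠ 0 := by
    intro h; rw [h] at hcard; simp at hcard
  have hf0 : f ≠ 0 := by rintro rfl; simp at hf
  set S : Finset F := {x | f.eval x = 0} with hS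
  set h : F[X] := ∏ x ∈ S, (X - C x) with hh
  have hhdeg : h.natDegree = S.card := natDegree_finsetProd_X_sub_C_eq_card S (fun x => x)
  have hh0 : h ≠ 0 := (monic_prod_X_sub_C _ _).ne_zero
  obtain ⟨f₁, hf₁⟩ : h ∣ f := by
    refine Finset.prod_dvd_of_coprime
      ((pairwise_coprime_X_sub_C Function.injective_id).set_pairwise _)
      fun x hx => dvd_iff_isRoot.2 ?_
    simpa [hS] using hx
  have hf₁0 : f₁ ≠ 0 := by rintro rfl; simp [hf₁] at hf0
  have hdeg₁ : S.card + f₁.natDegree = 3 := by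
    rw [← hhdeg, ← natDegree_mul hh0 hf₁0, ← hf₁, hf]
  obtain ⟨g, hg⟩ : X ^ Fintype.card F - X ∣ h * (f ^ m - 1) := by
    refine X_pow_card_sub_X_dvd fun x => ?_
    by_cases hx : f.eval x = 0
    · have : h.eval x = 0 := by
        rw [hh, eval_prod]
        exact Finset.prod_eq_zero (i := x) (by simpa [hS] using hx) (by simp)
      rw [eval_mul, this, zero_mul]
    · obtain ⟨y, hy⟩ := hsq x
      have hy0 : y ≠ 0 := by rintro rfl; simp [hx] at hy
      have : (f.eval x) ^ m = 1 := by
        rw [hy, ← pow_two, ← pow_mul, ← FiniteField.pow_card_sub_one_eq_one y hy0, hm]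
        congr 1
      rw [eval_mul, eval_sub, eval_pow, this]
      simp
  set v : F[X] := X ^ Fintype.card F - X with hv
  have hvdeg : v.natDegree = Fintype.card F := FiniteField.X_pow_card_sub_X_natDegree_eq F hq1
  have hv0 : v ≠ 0 := FiniteField.X_pow_card_sub_X_ne_zero F hq1
  have hm0 : 0 < m := by omega
  have hu : (f ^ m - 1).natDegree = 3 * m := by
    rw [← C_1, natDegree_sub_C, natDegree_pow, hf, mul_comm]
  have hu0 : f ^ m - 1 ≠ 0 := by
    intro h; rw [h, natDegree_zero] at hu; omega
  have hg0 : g ≠ 0 := by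
    rintro rfl; rw [mul_zero] at hg; exact mul_ne_zero hh0 hu0 hg
  have hgdeg : S.card + 3 * m = Fintype.card F + g.natDegree := by
    rw [← hhdeg, ← hu, ← natDegree_mul hh0 hu0, hg, natDegree_mul hv0 hg0, hvdeg]
  have hv' : derivative v = -1 := by
    rw [hv, derivative_sub, derivative_X_pow, derivative_X]
    simp
  have hder := congrArg derivative hg
  rw [derivative_mul, derivative_mul, derivative_sub, derivative_pow, hv', derivative_one] at hder
  have hpow : f ^ (m - 1) * f = f ^ m := by rw [← pow_succ]; congr 1; omega
  have key : v * (2 * f₁ * derivative h * g - derivative f * g - 2 * h * f₁ * derivative g) =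
      h * (derivative f - 2 * f₁ * g) := by
    refine mul_left_cancel₀ hh0 ?_
    have hder' : 2 * (f * derivative h * (f ^ m - 1)) + 2 * (m : F[X]) * h * f ^ m * derivative f =
        2 * f * (-1 * g + v * derivative g) := by
      rw [← hder, ← hpow, sub_zero, map_natCast]
      ring
    have hm2 : 2 * (m : F[X]) = -1 := by linear_combination hcard
    rw [hm2] at hder'
    rw [hf₁] at hder' hg ⊢
    linear_combination h * hder' + (h * derivative (h * f₁) - 2 * h * f₁ * derivative h) * hg
  by_cases hR : derivative f - 2 * f₁ * g = 0
  · exfalso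
    have h1 : (derivative f).natDegree ≤ 2 := (natDegree_derivative_le f).trans (by omega)
    have h3 : (2 * f₁ * g).natDegree = f₁.natDegree + g.natDegree := by
      rw [natDegree_mul (mul_ne_zero h2 hf₁0) hg0, natDegree_mul h2 hf₁0, natDegree_ofNat, zero_add]
    rw [← sub_eq_zero.1 hR] at h3
    omega
  · have h1 : Fintype.card F ≤ (h * (derivative f - 2 * f₁ * g)).natDegree := by
      rw [← hvdeg]
      exact natDegree_le_of_dvd ⟨_, key.symm⟩ (mul_ne_zero hh0 hR)
    have h3 : (derivative f - 2 * f₁ * g).natDegree ≤ max 2 (f₁.natDegree + g.natDegree) := by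
      refine (natDegree_sub_le _ _).trans (max_le_max ?_ ?_)
      · exact (natDegree_derivative_le f).trans (by omega)
      · rw [natDegree_mul (mul_ne_zero h2 hf₁0) hg0, natDegree_mul h2 hf₁0, natDegree_ofNat,
          zero_add]
    rw [natDegree_mul hh0 hR, hhdeg] at h1
    omega

end SquareValues

section PointCount

open Polynomial WeierstrassCurve.Affine

variable {F : Type*} [Field F]

lemma two_ne_zero_of_odd_card [Fintype F] (hq : Odd (Fintype.card F)) : (2 : F) ≠ 0 := by
  refine Ring.two_ne_zero fun h => ?_
  rw [← Nat.not_even_iff_odd, Nat.even_iff] at hq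
  exact hq (FiniteField.even_card_iff_char_two.1 h)

/-- The curve `y² = x³ + s x + t`. -/
def shortCurve (s t : F) : WeierstrassCurve.Affine F := ⟨0, 0, 0, s, t⟩

lemma shortCurve_equation_iff {s t x y : F} :
    (shortCurve s t).Equation x y ↔ y ^ 2 = x ^ 3 + s * x + t := by
  rw [equation_iff]
  simp [shortCurve]

lemma shortCurve_nonsingular_iff {s t : F} (h2 : (2 : F) ≠ 0)
    (hdisc : 4 * s ^ 3 + 27 * t ^ 2 ≠ 0) {x y : F} :
    (shortCurve s t).Nonsingular x y ↔ y ^ 2 = x ^ 3 + s * x + t := by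
  rw [← equation_iff_nonsingular_of_Δ_ne_zero, shortCurve_equation_iff]
  have h : (shortCurve s t).Δ = -(2 ^ 4) * (4 * s ^ 3 + 27 * t ^ 2) := by
    simp only [WeierstrassCurve.Δ, WeierstrassCurve.b₂, WeierstrassCurve.b₄, WeierstrassCurve.b₆,
      WeierstrassCurve.b₈, shortCurve]
    ring
  rw [h]
  exact mul_ne_zero (neg_ne_zero.2 (pow_ne_zero 4 h2)) hdisc

variable [Fintype F] [DecidableEq F]

instance (W : WeierstrassCurve.Affine F) : Finite W.Point :=
  have : Finite (WithZero {xy : F × F // W.Nonsingular xy.1 xy.2}) :=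
    inferInstanceAs (Finite (Option _))
  Finite.of_equiv _ W.nonsingularPointEquiv.symm

noncomputable instance (W : WeierstrassCurve.Affine F) : Fintype W.Point := Fintype.ofFinite _

noncomputable instance (W : WeierstrassCurve.Affine F) : DecidableEq W.Point := Classical.decEq _

lemma card_shortCurve_point {s t : F} (h2 : (2 : F) ≠ 0) (hdisc : 4 * s ^ 3 + 27 * t ^ 2 ≠ 0) :
    Fintype.card (shortCurve s t).Point = numPoints F s t := by
  rw [numPoints, ← Finset.card_univ, ← Finset.card_erase_add_one (Finset.mem_univ 0)]
  congr 1
  symm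
  refine Finset.card_bij (fun Q hQ => Point.some Q.1 Q.2
    ((shortCurve_nonsingular_iff h2 hdisc).2 (Finset.mem_filter.1 hQ).2)) ?_ ?_ ?_
  · intro Q hQ
    exact Finset.mem_erase.2 ⟨Point.some_ne_zero _, Finset.mem_univ _⟩
  · intro Q hQ R hR h
    rw [Point.some.injEq] at h
    exact Prod.ext h.1 h.2
  · rintro (_ | ⟨x, y, h⟩) hQ
    · exact ((Finset.mem_erase.1 hQ).1 rfl).elim
    · exact ⟨(x, y), Finset.mem_filter.2 ⟨Finset.mem_univ _,
        (shortCurve_nonsingular_iff h2 hdisc).1 h⟩, rfl⟩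

lemma card_two_torsion_shortCurve {s t : F} (h2 : (2 : F) ≠ 0)
    (hdisc : 4 * s ^ 3 + 27 * t ^ 2 ≠ 0) :
    ({Q : (shortCurve s t).Point | Q + Q = 0} : Finset _).card =
      ({x : F | x ^ 3 + s * x + t = 0} : Finset F).card + 1 := by
  rw [← Finset.card_erase_add_one (a := (0 : (shortCurve s t).Point)) (by simp)]
  congr 1
  symm
  have hneg : ∀ x y : F, (shortCurve s t).negY x y = -y := fun x y => by
    simp [negY, shortCurve]
  refine Finset.card_bij (fun x hx => Point.some x 0
    ((shortCurve_nonsingular_iff h2 hdisc).2 (by simpa using (Finset.mem_filter.1 hx).2.symm)))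
    ?_ ?_ ?_
  · intro x hx
    refine Finset.mem_erase.2 ⟨Point.some_ne_zero _, Finset.mem_filter.2 ⟨Finset.mem_univ _, ?_⟩⟩
    exact Point.add_self_of_Y_eq (by rw [hneg, neg_zero])
  · intro x hx y hy h
    rw [Point.some.injEq] at h
    exact h.1
  · rintro (_ | ⟨x, y, h⟩) hQ
    · exact ((Finset.mem_erase.1 hQ).1 rfl).elim
    · have hQ' := (Finset.mem_filter.1 (Finset.mem_erase.1 hQ).2).2
      rw [add_eq_zero_iff_eq_neg, Point.neg_some, Point.some.injEq, hneg] at hQ'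
      obtain rfl : y = 0 := by
        have : 2 * y = 0 := by linear_combination hQ'.2
        exact (mul_eq_zero.1 this).resolve_left h2
      refine ⟨x, Finset.mem_filter.2 ⟨Finset.mem_univ _, ?_⟩, rfl⟩
      simpa using ((shortCurve_nonsingular_iff h2 hdisc).1 h).symm

lemma card_roots_cubic_le {s t : F} :
    ({x : F | x ^ 3 + s * x + t = 0} : Finset F).card ≤ 3 := by
  have hdeg : (X ^ 3 + C s * X + C t : F[X]).natDegree = 3 := by compute_degree!
  refine (card_le_degree_of_subset_roots (p := X ^ 3 + C s * X + C t) fun x hx => ?_).trans_eq hdeg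
  have hx' := (Finset.mem_filter.1 (Finset.mem_def.2 hx)).2
  rw [mem_roots (fun h0 => by simp [h0] at hdeg)]
  simpa using hx'

lemma card_roots_cubic_ne_two {s t : F} (hdisc : 4 * s ^ 3 + 27 * t ^ 2 ≠ 0) :
    ({x : F | x ^ 3 + s * x + t = 0} : Finset F).card ≠ 2 := by
  intro h
  obtain ⟨a, b, hab, heq⟩ := Finset.card_eq_two.1 h
  have hroot : ∀ x, x ^ 3 + s * x + t = 0 ↔ x = a ∨ x = b := fun x => by
    have : x ∈ ({x : F | x ^ 3 + s * x + t = 0} : Finset F) ↔ x = a ∨ x = b := by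
      rw [heq]; simp
    simpa using this
  have ha := (hroot a).2 (Or.inl rfl)
  have hb := (hroot b).2 (Or.inr rfl)
  have hs : s = -(a ^ 2 + a * b + b ^ 2) := by
    refine mul_left_cancel₀ (sub_ne_zero.2 hab) ?_
    linear_combination ha - hb
  have ht : t = a * b * (a + b) := by
    rw [hs] at ha
    linear_combination ha
  refine hdisc ?_
  rcases (hroot (-a - b)).1 (by rw [hs, ht]; ring) with h | h
  · obtain rfl : b = -2 * a := by linear_combination -h
    rw [hs, ht]; ring
  · obtain rfl : a = -2 * b := by linear_combination -h
    rw [hs, ht]; ring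

lemma card_affine_add_card_roots_le (s t : F) :
    ({Q : F × F | Q.2 ^ 2 = Q.1 ^ 3 + s * Q.1 + t} : Finset (F × F)).card +
      ({x : F | x ^ 3 + s * x + t = 0} : Finset F).card ≤
    2 * ({x : F | IsSquare (x ^ 3 + s * x + t)} : Finset F).card := by
  rw [Finset.card_eq_sum_card_fiberwise (f := Prod.fst) (t := Finset.univ) (fun _ _ => by simp),
    Finset.card_filter, Finset.card_filter, ← Finset.sum_add_distrib, Finset.mul_sum]
  refine Finset.sum_le_sum fun x _ => ?_
  have hfib : (({Q : F × F | Q.2 ^ 2 = Q.1 ^ 3 + s * Q.1 + t} : Finset (F × F)).filter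
      (fun Q => Q.1 = x)).card ≤ ({y : F | y ^ 2 = x ^ 3 + s * x + t} : Finset F).card := by
    refine Finset.card_le_card_of_injOn Prod.snd ?_ ?_
    · intro Q hQ
      simp only [Finset.coe_filter, Finset.mem_filter, Finset.mem_univ, true_and,
        Set.mem_ofPred_eq] at hQ ⊢
      rw [← hQ.2]
      exact hQ.1
    · intro Q hQ R hR h
      simp only [Finset.coe_filter, Finset.mem_filter, Finset.mem_univ, true_and,
        Set.mem_ofPred_eq] at hQ hR
      exact Prod.ext (hQ.2.trans hR.2.symm) h
  refine (add_le_add_left hfib _).trans ?_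
  by_cases hsq : IsSquare (x ^ 3 + s * x + t)
  · rw [if_pos hsq]
    obtain ⟨r, hr⟩ := hsq
    have hsub : ({y : F | y ^ 2 = x ^ 3 + s * x + t} : Finset F) ⊆ {r, -r} := by
      intro y hy
      have hy' := (Finset.mem_filter.1 hy).2
      rw [hr, ← sq] at hy'
      simpa using sq_eq_sq_iff_eq_or_eq_neg.1 hy'
    have hle := Finset.card_le_card hsub
    by_cases h0 : x ^ 3 + s * x + t = 0
    · rw [h0, eq_comm, mul_self_eq_zero] at hr
      rw [if_pos h0]
      rw [hr, neg_zero, Finset.pair_eq_singleton, Finset.card_singleton] at hle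
      omega
    · rw [if_neg h0]
      have := Finset.card_le_two (a := r) (b := -r)
      omega
  · have h0 : x ^ 3 + s * x + t ≠ 0 := fun h0 => hsq (h0 ▸ IsSquare.zero)
    rw [if_neg h0, if_neg hsq, add_zero, mul_zero, Nat.le_zero, Finset.card_eq_zero]
    refine Finset.filter_eq_empty_iff.2 fun y _ hy => hsq ⟨y, ?_⟩
    rw [← hy, sq]

/-- Long sets of affine points contain `k` distinct points adding up to zero. -/
lemma hasSubsetSum_zero_shortCurve (hq : Odd (Fintype.card F)) {s t : F}
    (hdisc : 4 * s ^ 3 + 27 * t ^ 2 ≠ 0) {D : Finset (shortCurve s t).Point} (h0 : 0 ∉ D)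
    (hD : Fintype.card F + 3 ≤ D.card) {k : ℕ} (hk : 2 ≤ k) (hkD : k + 2 ≤ D.card) :
    HasSubsetSum D k 0 := by
  have h2 := two_ne_zero_of_odd_card hq
  have hN := card_shortCurve_point h2 hdisc
  have hτ := card_two_torsion_shortCurve h2 hdisc
  have he := card_roots_cubic_le (s := s) (t := t)
  have he2 := card_roots_cubic_ne_two hdisc
  have hA := card_affine_add_card_roots_le s t
  have hsq := Finset.card_le_univ ({x : F | IsSquare (x ^ 3 + s * x + t)} : Finset F)
  have hall : ({x : F | IsSquare (x ^ 3 + s * x + t)} : Finset F).card = Fintype.card F →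
      Fintype.card F ≤ 2 * ({x : F | x ^ 3 + s * x + t = 0} : Finset F).card + 3 := by
    intro h
    rw [Finset.card_eq_iff_eq_univ] at h
    have hdeg : (X ^ 3 + C s * X + C t : F[X]).natDegree = 3 := by compute_degree!
    have := card_le_of_forall_isSquare_eval hq hdeg (fun x => by
      have : x ∈ ({x : F | IsSquare (x ^ 3 + s * x + t)} : Finset F) := by
        rw [h]
        exact Finset.mem_univ x
      simpa using this)
    simpa using this
  rw [numPoints] at hN
  refine hasSubsetSum_zero h0 ?_ ?_ ?_ ?_ hk hkD <;> rw [hτ]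
  · omega
  · omega
  · omega
  · omega

end PointCount

section CoordinateRing

open Polynomial WeierstrassCurve.Affine WeierstrassCurve.Affine.CoordinateRing
open scoped Polynomial.Bivariate nonZeroDivisors

variable {F : Type*} [Field F] {W : WeierstrassCurve.Affine F}

/-- Evaluation of regular functions at an affine point. -/
noncomputable def evalPoint {Q : F × F} (h : W.Equation Q.1 Q.2) : W.CoordinateRing →+* F :=
  AdjoinRoot.lift (evalRingHom Q.1) Q.2 (by
    rw [eval₂_evalRingHom]
    exact h)

lemma evalPoint_smul_basis {Q : F × F} (h : W.Equation Q.1 Q.2) (p q : F[X]) :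
    evalPoint h (p • (1 : W.CoordinateRing) + q • CoordinateRing.mk W Y) =
      p.eval Q.1 + q.eval Q.1 * Q.2 := by
  simp only [CoordinateRing.smul, mul_one, map_add, map_mul]
  simp [evalPoint]

lemma evalPoint_XClass {Q : F × F} (h : W.Equation Q.1 Q.2) (x : F) :
    evalPoint h (XClass W x) = Q.1 - x := by
  simp [evalPoint, XClass]

lemma evalPoint_YClass {Q : F × F} (h : W.Equation Q.1 Q.2) (y : F) :
    evalPoint h (YClass W (C y)) = Q.2 - y := by
  simp [evalPoint, YClass]

lemma evalPoint_smul {Q : F × F} (h : W.Equation Q.1 Q.2) (a : F) (f : W.CoordinateRing) :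
    evalPoint h (a • f) = a * evalPoint h f := by
  rw [← algebraMap_smul F[X] a f, CoordinateRing.smul, map_mul]
  simp [evalPoint]

lemma XYIdeal_le_ker {Q : F × F} (h : W.Equation Q.1 Q.2) :
    XYIdeal W Q.1 (C Q.2) ≤ RingHom.ker (evalPoint h) := by
  rw [XYIdeal, Ideal.span_le]
  rintro f (rfl | rfl)
  · simp [evalPoint_XClass]
  · simp [evalPoint_YClass]

lemma isMaximal_XYIdeal {Q : F × F} (h : W.Equation Q.1 Q.2) :
    (XYIdeal W Q.1 (C Q.2)).IsMaximal := by
  refine Ideal.Quotient.maximal_of_isField _ ?_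
  exact (quotientXYIdealEquiv (W' := W) (x := Q.1) (y := C Q.2) h).toMulEquiv.isField
    (Field.toIsField F)

lemma ker_evalPoint {Q : F × F} (h : W.Equation Q.1 Q.2) :
    RingHom.ker (evalPoint h) = XYIdeal W Q.1 (C Q.2) :=
  ((isMaximal_XYIdeal h).eq_of_le (RingHom.ker_ne_top _) (XYIdeal_le_ker h)).symm

section EvalPoints

variable {ι : Type*} {P : ι → F × F} (h : ∀ i, W.Equation (P i).1 (P i).2)

/-- Evaluation of regular functions at a family of affine points. -/
noncomputable def evalPoints : W.CoordinateRing →ₗ[F] ι → F where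
  toFun f i := evalPoint (h i) f
  map_add' f g := by ext; simp
  map_smul' a f := by ext; simp [evalPoint_smul]

lemma evalPoints_apply (f : W.CoordinateRing) (i : ι) :
    evalPoints h f i = evalPoint (h i) f := rfl

lemma evalPoints_surjective [Fintype ι] (hP : Function.Injective P) :
    Function.Surjective (evalPoints h) := by
  classical
  have sep : ∀ i j, i ≠ j → ∃ f, evalPoint (h i) f ≠ 0 ∧ evalPoint (h j) f = 0 := by
    intro i j hij
    by_cases hx : (P i).1 = (P j).1
    · refine ⟨YClass W (C (P j).2), ?_, ?_⟩
      · rw [evalPoint_YClass, sub_ne_zero]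
        exact fun hy => hij (hP (Prod.ext hx hy))
      · rw [evalPoint_YClass, sub_self]
    · refine ⟨XClass W (P j).1, ?_, ?_⟩
      · rwa [evalPoint_XClass, sub_ne_zero]
      · rw [evalPoint_XClass, sub_self]
  choose! f hf hf' using sep
  rw [← LinearMap.range_eq_top, eq_top_iff, ← (Pi.basisFun F ι).span_eq, Submodule.span_le]
  rintro _ ⟨i, rfl⟩
  have hne : evalPoint (h i) (∏ j ∈ Finset.univ.erase i, f i j) ≠ 0 := by
    rw [map_prod, Finset.prod_ne_zero_iff]
    exact fun j hj => hf i j (Finset.ne_of_mem_erase hj).symm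
  refine ⟨(evalPoint (h i) (∏ j ∈ Finset.univ.erase i, f i j))⁻¹ •
    ∏ j ∈ Finset.univ.erase i, f i j, ?_⟩
  ext j
  rw [evalPoints_apply, evalPoint_smul, Pi.basisFun_apply]
  by_cases hij : j = i
  · subst hij
    rw [inv_mul_cancel₀ hne, Pi.single_eq_same]
  · have hz : evalPoint (h j) (∏ j ∈ Finset.univ.erase i, f i j) = 0 := by
      rw [map_prod]
      exact Finset.prod_eq_zero (Finset.mem_erase.2 ⟨hij, Finset.mem_univ j⟩)
        (hf' i j (Ne.symm hij))
    rw [hz, mul_zero, Pi.single_eq_of_ne hij]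

/-- The ideal of functions vanishing at a family of points. -/
noncomputable def vanishingIdeal : Ideal W.CoordinateRing := ⨅ i, RingHom.ker (evalPoint (h i))

lemma mem_vanishingIdeal {f : W.CoordinateRing} :
    f ∈ vanishingIdeal h ↔ evalPoints h f = 0 := by
  simp [vanishingIdeal, funext_iff, evalPoints_apply, RingHom.mem_ker]

/-- Functions modulo the vanishing ideal are the values at the points. -/
noncomputable def quotientVanishingIdealEquiv [Fintype ι] (hP : Function.Injective P) :
    (W.CoordinateRing ⧸ vanishingIdeal h) ≃ₗ[F] ι → F :=
  (Submodule.quotEquivOfEq ((vanishingIdeal h).restrictScalars F) (LinearMap.ker (evalPoints h))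
    (by ext f; simpa using mem_vanishingIdeal h)).trans
    ((evalPoints h).quotKerEquivOfSurjective (evalPoints_surjective h hP))

lemma finrank_quotient_vanishingIdeal [Fintype ι] (hP : Function.Injective P) :
    Module.finrank F (W.CoordinateRing ⧸ vanishingIdeal h) = Fintype.card ι := by
  rw [(quotientVanishingIdealEquiv h hP).finrank_eq, Module.finrank_fintype_fun_eq_card]

lemma finite_quotient_span {f : W.CoordinateRing} (hf : f ≠ 0) :
    Module.Finite F (W.CoordinateRing ⧸ Ideal.span {f}) := by
  have hI : Ideal.span {f} ≠ ⊥ := by simpa using hf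
  exact Module.Finite.equiv
    (Ideal.quotientEquivDirectSum F (CoordinateRing.basis W) hI).symm

lemma card_le_natDegree_norm [Fintype ι] (hP : Function.Injective P) {f : W.CoordinateRing}
    (hf : f ≠ 0) (hfP : evalPoints h f = 0) :
    Fintype.card ι ≤ (Algebra.norm F[X] f).natDegree := by
  have := finite_quotient_span hf
  rw [← finrank_quotient_span_eq_natDegree_norm (CoordinateRing.basis W) hf,
    ← finrank_quotient_vanishingIdeal h hP]
  have hle : Ideal.span {f} ≤ vanishingIdeal h := by
    rw [Ideal.span_singleton_le_iff_mem, mem_vanishingIdeal, hfP]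
  exact LinearMap.finrank_le_finrank_of_surjective (f := (Ideal.Quotient.factorₐ F hle).toLinearMap)
    (Ideal.Quotient.factor_surjective hle)

lemma span_eq_vanishingIdeal [Fintype ι] (hP : Function.Injective P) {f : W.CoordinateRing}
    (hf : f ≠ 0) (hfP : evalPoints h f = 0)
    (hdeg : (Algebra.norm F[X] f).natDegree ≤ Fintype.card ι) :
    Ideal.span {f} = vanishingIdeal h := by
  have := finite_quotient_span hf
  have hle : Ideal.span {f} ≤ vanishingIdeal h := by
    rw [Ideal.span_singleton_le_iff_mem, mem_vanishingIdeal, hfP]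
  refine le_antisymm hle fun g hg => ?_
  have hsurj : Function.Surjective (Ideal.Quotient.factorₐ F hle).toLinearMap :=
    Ideal.Quotient.factor_surjective hle
  have hdim : Module.finrank F (W.CoordinateRing ⧸ Ideal.span {f}) =
      Module.finrank F (W.CoordinateRing ⧸ vanishingIdeal h) := by
    refine le_antisymm ?_ (LinearMap.finrank_le_finrank_of_surjective hsurj)
    rwa [finrank_quotient_span_eq_natDegree_norm (CoordinateRing.basis W) hf,
      finrank_quotient_vanishingIdeal h hP]
  have : Module.Finite F (W.CoordinateRing ⧸ vanishingIdeal h) := .of_surjective _ hsurj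
  have hinj := (LinearMap.injective_iff_surjective_of_finrank_eq_finrank hdim).2 hsurj
  rw [← Ideal.Quotient.eq_zero_iff_mem]
  apply hinj
  rw [map_zero]
  exact Ideal.Quotient.eq_zero_iff_mem.2 hg

end EvalPoints

variable (W) in
/-- The coordinate ring is spanned by `1` and `Y` over `F[X]`. -/
noncomputable def smulBasisEquiv : (F[X] × F[X]) ≃ₗ[F] W.CoordinateRing :=
  LinearEquiv.ofBijective
    ((LinearMap.toSpanSingleton F[X] W.CoordinateRing 1).restrictScalars F |>.coprod
      ((LinearMap.toSpanSingleton F[X] W.CoordinateRing (CoordinateRing.mk W Y)).restrictScalars F))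
    ⟨by
      rw [← LinearMap.ker_eq_bot, LinearMap.ker_eq_bot']
      rintro ⟨p, q⟩ hpq
      obtain ⟨rfl, rfl⟩ := smul_basis_eq_zero (W' := W) (p := p) (q := q) (by simpa using hpq)
      rfl, fun f => by
      obtain ⟨p, q, rfl⟩ := exists_smul_basis_eq f
      exact ⟨(p, q), by simp⟩⟩

lemma smulBasisEquiv_apply (p q : F[X]) :
    smulBasisEquiv W (p, q) = p • (1 : W.CoordinateRing) + q • CoordinateRing.mk W Y := by
  simp [smulBasisEquiv]

variable (W) in
/-- The Riemann–Roch space `L(kO)`. -/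
noncomputable def rrSpace (k : ℕ) : Submodule F W.CoordinateRing :=
  ((degreeLT F (k / 2 + 1)).prod (degreeLT F ((k - 1) / 2))).map (smulBasisEquiv W).toLinearMap

lemma smul_basis_mem_rrSpace {k : ℕ} {p q : F[X]} :
    p • (1 : W.CoordinateRing) + q • CoordinateRing.mk W Y ∈ rrSpace W k ↔
      p ∈ degreeLT F (k / 2 + 1) ∧ q ∈ degreeLT F ((k - 1) / 2) := by
  rw [← smulBasisEquiv_apply, rrSpace, Submodule.mem_map_equiv, LinearEquiv.symm_apply_apply]
  rfl

lemma mem_rrSpace {k : ℕ} {f : W.CoordinateRing} :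
    f ∈ rrSpace W k ↔ (Algebra.norm F[X] f).natDegree ≤ k := by
  obtain ⟨p, q, rfl⟩ := exists_smul_basis_eq f
  rw [smul_basis_mem_rrSpace, natDegree_le_iff_degree_le, degree_norm_smul_basis, max_le_iff,
    mem_degreeLT, mem_degreeLT]
  refine and_congr ?_ ?_
  · by_cases hp : p = 0
    · simp [hp]
    · rw [degree_eq_natDegree hp]
      norm_cast
      rw [two_nsmul]
      norm_cast
      omega
  · by_cases hp : q = 0
    · simp [hp]
    · rw [degree_eq_natDegree hp]
      norm_cast
      rw [two_nsmul]
      norm_cast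
      omega

lemma rrSpace_mono {k l : ℕ} (hkl : k ≤ l) : rrSpace W k ≤ rrSpace W l := fun _ hf =>
  mem_rrSpace.2 ((mem_rrSpace.1 hf).trans hkl)

lemma rrSpace_eq_range (k : ℕ) :
    rrSpace W k = LinearMap.range ((smulBasisEquiv W).toLinearMap ∘ₗ
      (degreeLT F (k / 2 + 1)).subtype.prodMap (degreeLT F ((k - 1) / 2)).subtype) := by
  rw [LinearMap.range_comp, LinearMap.range_prodMap, Submodule.range_subtype,
    Submodule.range_subtype, rrSpace]

lemma finrank_rrSpace {k : ℕ} (hk : 1 ≤ k) : Module.finrank F (rrSpace W k) = k := by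
  rw [rrSpace_eq_range, LinearMap.finrank_range_of_inj, Module.finrank_prod,
    (degreeLTEquiv F _).finrank_eq, (degreeLTEquiv F _).finrank_eq, Module.finrank_fin_fun,
    Module.finrank_fin_fun]
  · omega
  · exact (smulBasisEquiv W).injective.comp
      (Prod.map_injective.2 ⟨Subtype.val_injective, Subtype.val_injective⟩)

instance (k : ℕ) : Module.Finite F (rrSpace W k) := by
  have : Module.Finite F (degreeLT F (k / 2 + 1)) := .equiv (degreeLTEquiv F _).symm
  have : Module.Finite F (degreeLT F ((k - 1) / 2)) := .equiv (degreeLTEquiv F _).symm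
  rw [rrSpace_eq_range]
  infer_instance

lemma exists_eq_smul_one_of_natDegree_norm_le_one {u : W.CoordinateRing}
    (hu : (Algebra.norm F[X] u).natDegree ≤ 1) : ∃ c : F, u = c • (1 : W.CoordinateRing) := by
  have h0 : u ∈ rrSpace W 0 := by
    rw [mem_rrSpace]
    have := natDegree_norm_ne_one u
    omega
  obtain ⟨p, q, rfl⟩ := exists_smul_basis_eq u
  obtain ⟨hp, hq⟩ := smul_basis_mem_rrSpace.1 h0
  rw [mem_degreeLT] at hp hq
  have hq0 : q = 0 := degree_eq_bot.1 (Nat.WithBot.lt_zero_iff.1 hq)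
  have hp0 : p = C (p.coeff 0) := by
    refine eq_C_of_degree_le_zero (natDegree_le_iff_degree_le.1 (Nat.le_of_lt_succ ?_))
    by_cases h : p = 0
    · simp [h]
    · exact (natDegree_lt_iff_degree_lt h).2 hp
  refine ⟨p.coeff 0, ?_⟩
  rw [hq0, zero_smul, add_zero, hp0, ← algebraMap_eq, algebraMap_smul, algebraMap_eq, coeff_C_zero]

section EvalPoints

variable {ι : Type*} [Fintype ι] {P : ι → F × F} (h : ∀ i, W.Equation (P i).1 (P i).2)

include h in
lemma card_le_of_mem_rrSpace (hP : Function.Injective P) {k : ℕ} {f : W.CoordinateRing}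
    (hf : f ≠ 0) (hfP : evalPoints h f = 0) (hk : f ∈ rrSpace W k) : Fintype.card ι ≤ k :=
  (card_le_natDegree_norm h hP hf hfP).trans (mem_rrSpace.1 hk)

lemma exists_mem_rrSpace_evalPoints_eq (hP : Function.Injective P) {k : ℕ}
    (hk : Fintype.card ι < k) (g : ι → F) : ∃ f ∈ rrSpace W k, evalPoints h f = g := by
  rcases Nat.eq_zero_or_pos (Fintype.card ι) with h0 | hpos
  · have := Fintype.card_eq_zero_iff.1 h0
    exact ⟨0, zero_mem _, Subsingleton.elim _ _⟩
  set m := Fintype.card ι with hm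
  let E := (evalPoints h).domRestrict (rrSpace W (m + 1))
  have hker : Module.finrank F (LinearMap.ker E) ≤ 1 := by
    by_cases hex : ∃ f₀ ∈ rrSpace W m, f₀ ≠ 0 ∧ evalPoints h f₀ = 0
    · obtain ⟨f₀, hf₀, hne, hev⟩ := hex
      have hspan := span_eq_vanishingIdeal h hP hne hev (mem_rrSpace.1 hf₀)
      have hcard := card_le_natDegree_norm h hP hne hev
      refine finrank_le_one ⟨⟨f₀, rrSpace_mono (Nat.le_succ m) hf₀⟩, hev⟩ ?_
      rintro ⟨⟨w, hw⟩, hwE⟩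
      have hw0 : w ∈ Ideal.span {f₀} := by
        rw [hspan, mem_vanishingIdeal]
        exact hwE
      obtain ⟨u, rfl⟩ := Ideal.mem_span_singleton'.1 hw0
      by_cases hu : u = 0
      · exact ⟨0, by ext; simp [hu]⟩
      have hN : ∀ {f : W.CoordinateRing}, f ≠ 0 → Algebra.norm F[X] f ≠ 0 := fun hf => by
        rwa [Ne, Algebra.norm_eq_zero_iff_of_basis (CoordinateRing.basis W)]
      rw [mem_rrSpace, map_mul, natDegree_mul (hN hu) (hN hne)] at hw
      obtain ⟨c, rfl⟩ := exists_eq_smul_one_of_natDegree_norm_le_one (u := u) (by omega)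
      exact ⟨c, by ext; simp⟩
    · push Not at hex
      let L := (rrSpace W m).comap (rrSpace W (m + 1)).subtype
      have hL : Module.finrank F L = m := by
        rw [(Submodule.comapSubtypeEquivOfLe (rrSpace_mono (Nat.le_succ m))).finrank_eq,
          finrank_rrSpace hpos]
      have hinf : LinearMap.ker E ⊓ L = ⊥ := by
        rw [eq_bot_iff]
        rintro ⟨w, hw⟩ ⟨hw1, hw2⟩
        by_contra hne
        exact hex w hw2 (fun h0 => hne (by simp [h0])) hw1
      have hdim := Submodule.finrank_sup_add_finrank_inf_eq (LinearMap.ker E) L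
      have hle := Submodule.finrank_le (LinearMap.ker E ⊔ L)
      rw [finrank_rrSpace (Nat.le_add_left 1 m)] at hle
      rw [hinf, finrank_bot, hL] at hdim
      omega
  have hrange : LinearMap.range E = ⊤ := by
    apply Submodule.eq_top_of_finrank_eq
    have := E.finrank_range_add_finrank_ker
    rw [finrank_rrSpace (Nat.le_add_left 1 m)] at this
    have hle := Submodule.finrank_le (LinearMap.range E)
    rw [Module.finrank_fintype_fun_eq_card] at hle ⊢
    omega
  obtain ⟨⟨f, hf⟩, hfg⟩ := LinearMap.range_eq_top.1 hrange g
  exact ⟨f, rrSpace_mono hk hf, hfg⟩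

lemma vanishingIdeal_eq_prod (hP : Function.Injective P) :
    vanishingIdeal h = ∏ i, XYIdeal W (P i).1 (C (P i).2) := by
  rw [Ideal.prod_eq_iInf_of_pairwise_isCoprime, vanishingIdeal]
  · simp [ker_evalPoint]
  · intro i _ j _ hij
    refine Ideal.isCoprime_iff_sup_eq.2
      ((isMaximal_XYIdeal (h i)).coprime_of_ne (isMaximal_XYIdeal (h j)) fun heq => hij ?_)
    change XYIdeal W (P i).1 (C (P i).2) = XYIdeal W (P j).1 (C (P j).2) at heq
    have hx : XClass W (P i).1 ∈ XYIdeal W (P j).1 (C (P j).2) :=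
      heq ▸ Ideal.subset_span (Set.mem_insert _ _)
    have hy : YClass W (C (P i).2) ∈ XYIdeal W (P j).1 (C (P j).2) :=
      heq ▸ Ideal.subset_span (Set.mem_insert_of_mem _ rfl)
    rw [← ker_evalPoint (h j), RingHom.mem_ker] at hx hy
    rw [evalPoint_XClass, sub_eq_zero] at hx
    rw [evalPoint_YClass, sub_eq_zero] at hy
    exact hP (Prod.ext hx hy).symm

lemma exists_mem_rrSpace_of_sum_eq_zero [DecidableEq F] (hP : Function.Injective P)
    (hns : ∀ i, W.Nonsingular (P i).1 (P i).2)
    (hsum : ∑ i, (Point.some _ _ (hns i) : W.Point) = 0) :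
    ∃ f ∈ rrSpace W (Fintype.card ι), f ≠ 0 ∧ evalPoints h f = 0 := by
  have h1 : ClassGroup.mk W.FunctionField (∏ i, XYIdeal' (W := W) (hns i)) = 1 := by
    rw [map_prod]
    have := congrArg Point.toClass hsum
    rw [map_sum, map_zero] at this
    exact this
  have h2 : ((∏ i, XYIdeal' (W := W) (hns i) : (FractionalIdeal W.CoordinateRing⁰ W.FunctionField)ˣ) :
      FractionalIdeal W.CoordinateRing⁰ W.FunctionField) =
      ((∏ i, XYIdeal W (P i).1 (C (P i).2) : Ideal W.CoordinateRing) :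
        FractionalIdeal W.CoordinateRing⁰ W.FunctionField) := by
    rw [Units.coe_prod]
    exact (map_prod (FractionalIdeal.coeIdealHom W.CoordinateRing⁰ W.FunctionField) _ _).symm
  obtain ⟨f, hf, hspan⟩ := (ClassGroup.mk_eq_one_of_coe_ideal h2).1 h1
  rw [← vanishingIdeal_eq_prod h hP] at hspan
  refine ⟨f, ?_, hf, ?_⟩
  · rw [mem_rrSpace, ← finrank_quotient_span_eq_natDegree_norm (CoordinateRing.basis W) hf,
      ← hspan, finrank_quotient_vanishingIdeal h hP]
  · rw [← mem_vanishingIdeal, hspan]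
    exact Ideal.mem_span_singleton_self f

end EvalPoints

end CoordinateRing

section Codes

variable {F : Type*} [Field F] {n : ℕ}

/-- The functional code as a subspace. -/
noncomputable def funcSub (k : ℕ) (P : Fin n → F × F) : Submodule F (Fin n → F) :=
  LinearMap.range (Hmat k P).vecMulLinear

/-- The residue code as a subspace. -/
noncomputable def resSub (k : ℕ) (P : Fin n → F × F) : Submodule F (Fin n → F) :=
  LinearMap.ker (Hmat k P).mulVecLin

lemma coe_funcSub (k : ℕ) (P : Fin n → F × F) :
    (funcSub k P : Set (Fin n → F)) = funcCode k P := by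
  ext v
  simp [funcSub, funcCode, eq_comm]

lemma coe_resSub (k : ℕ) (P : Fin n → F × F) :
    (resSub k P : Set (Fin n → F)) = resCode k P := by
  ext v
  simp [resSub, resCode]

lemma dimCode_coe (C : Submodule F (Fin n → F)) :
    dimCode F (C : Set (Fin n → F)) = Module.finrank F C := by
  rw [dimCode, Submodule.span_eq]

lemma mem_resSub {k : ℕ} {P : Fin n → F × F} {v : Fin n → F} :
    v ∈ resSub k P ↔ ∀ c ∈ funcSub k P, c ⬝ᵥ v = 0 := by
  rw [resSub, LinearMap.mem_ker, mulVecLin_apply]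
  constructor
  · rintro h _ ⟨u, rfl⟩
    rw [vecMulLinear_apply, ← dotProduct_mulVec, h, dotProduct_zero]
  · intro h
    refine dotProduct_eq_zero _ fun u => ?_
    rw [dotProduct_comm, dotProduct_mulVec]
    exact h _ ⟨u, rfl⟩

lemma finrank_resSub_add (k : ℕ) (P : Fin n → F × F) :
    Module.finrank F (resSub k P) + Module.finrank F (funcSub k P) = n := by
  have h1 : Module.finrank F (funcSub k P) = (Hmat k P).rank := by
    rw [← rank_transpose, Matrix.rank, mulVecLin_transpose]
    rfl
  have h2 := (Hmat k P).mulVecLin.finrank_range_add_finrank_ker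
  rw [Module.finrank_fin_fun] at h2
  rw [h1, resSub, Matrix.rank]
  omega

section HammingDistance

variable [DecidableEq F]

lemma minDist_eq {C : Submodule F (Fin n → F)} {d : ℕ}
    (hle : ∀ c ∈ C, c ≠ 0 → d ≤ hammingNorm c)
    (hex : ∃ c ∈ C, c ≠ 0 ∧ hammingNorm c ≤ d) : minDist (C : Set (Fin n → F)) = d := by
  obtain ⟨c, hc, hc0, hcd⟩ := hex
  rw [minDist]
  have hmem : hammingDist c 0 ∈ (fun c => hammingDist c 0) '' ((C : Set (Fin n → F)) \ {0}) :=
    ⟨c, ⟨hc, hc0⟩, rfl⟩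
  refine le_antisymm ((Nat.sInf_le hmem).trans ?_) (le_csInf ⟨_, hmem⟩ ?_)
  · simpa using hcd
  · rintro _ ⟨c', ⟨hc', hc0'⟩, rfl⟩
    simpa using hle c' hc' hc0'

lemma covRad_eq {C : Submodule F (Fin n → F)} {r : ℕ}
    (hub : ∀ u, ∃ c ∈ C, hammingDist u c ≤ r)
    (hlb : ∃ u, ∀ c ∈ C, r ≤ hammingDist u c) : covRad (C : Set (Fin n → F)) = r := by
  have hle : ∀ u, dTo u (C : Set (Fin n → F)) ≤ r := fun u => by
    obtain ⟨c, hc, hcr⟩ := hub u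
    exact (Nat.sInf_le (Set.mem_image_of_mem (hammingDist u) hc)).trans hcr
  obtain ⟨u, hu⟩ := hlb
  refine le_antisymm (csSup_le (Set.range_nonempty _) ?_) ?_
  · rintro _ ⟨u, rfl⟩
    exact hle u
  · refine le_trans ?_ (le_csSup (a := dTo u (C : Set (Fin n → F))) ⟨r, ?_⟩ ⟨u, rfl⟩)
    · refine le_csInf ⟨_, Set.mem_image_of_mem (hammingDist u) C.zero_mem⟩ ?_
      rintro _ ⟨c, hc, rfl⟩
      exact hu c hc
    · rintro _ ⟨u, rfl⟩
      exact hle u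

lemma hammingNorm_le_hammingNorm_comp_succAbove {m : ℕ} {v : Fin (m + 1) → F} {i : Fin (m + 1)}
    (hi : v i = 0) : hammingNorm v ≤ hammingNorm (fun j => v (i.succAbove j)) := by
  classical
  rw [hammingNorm, hammingNorm, ← Finset.card_map i.succAboveEmb]
  refine Finset.card_le_card fun j hj => ?_
  have hj' := (Finset.mem_filter.1 hj).2
  obtain ⟨l, rfl⟩ := Fin.exists_succAbove_eq (x := j) (y := i) (by rintro rfl; exact hj' hi)
  exact Finset.mem_map.2 ⟨l, Finset.mem_filter.2 ⟨Finset.mem_univ _, hj'⟩, rfl⟩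

/-- Shortening a code of large distance at a coordinate where it does not vanish. -/
lemma exists_shortened {m K d : ℕ} {C : Submodule F (Fin (m + 1) → F)}
    (hC : Module.finrank F C = K + 1) (hd : ∀ c ∈ C, c ≠ 0 → d ≤ hammingNorm c) :
    ∃ C' : Submodule F (Fin m → F), Module.finrank F C' = K ∧
      ∀ c ∈ C', c ≠ 0 → d ≤ hammingNorm c := by
  obtain ⟨c, hc, hc0⟩ := Submodule.exists_mem_ne_zero_of_ne_bot (p := C) (by
    rintro rfl
    simp at hC)
  obtain ⟨i, hi⟩ := Function.ne_iff.1 hc0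
  let ev : C →ₗ[F] F := (LinearMap.proj i).domRestrict C
  have hev : Module.finrank F (LinearMap.ker ev) = K := by
    have h := ev.finrank_range_add_finrank_ker
    rw [LinearMap.range_eq_top.2 (LinearMap.surjective (f := ev) fun h0 =>
      hi (by simpa [ev] using LinearMap.congr_fun h0 ⟨c, hc⟩)), finrank_top,
      Module.finrank_self, hC] at h
    omega
  let res : LinearMap.ker ev →ₗ[F] (Fin m → F) :=
    LinearMap.funLeft F F i.succAbove ∘ₗ C.subtype ∘ₗ (LinearMap.ker ev).subtype
  have hnorm : ∀ w : LinearMap.ker ev, hammingNorm w.1.1 ≤ hammingNorm (res w) := fun w =>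
    hammingNorm_le_hammingNorm_comp_succAbove w.2
  refine ⟨LinearMap.range res, ?_, ?_⟩
  · have hres : ∀ w, res w = 0 → w = 0 := fun w hw => by
      have := hnorm w
      rw [hw, hammingNorm_zero, Nat.le_zero, hammingNorm_eq_zero] at this
      exact Subtype.ext (Subtype.ext this)
    rw [LinearMap.finrank_range_of_inj fun w w' hw => ?_, hev]
    exact sub_eq_zero.1 (hres _ ((LinearMap.map_sub res w w').trans (sub_eq_zero.2 hw)))
  · rintro _ ⟨w, rfl⟩ hw
    refine (hd _ w.1.2 ?_).trans (hnorm w)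
    intro h0
    refine hw ?_
    have : w = 0 := Subtype.ext (Subtype.ext h0)
    rw [this, map_zero]

/-- If no longer MDS code exists, an MDS code has small covering radius. -/
lemma exists_hammingDist_le {C : Submodule F (Fin n → F)} {K : ℕ} (hK : 1 ≤ K) (hKn : K < n)
    (hC : Module.finrank F C = K) (hd : ∀ c ∈ C, c ≠ 0 → n - K ≤ hammingNorm c)
    (hmds : ∀ C' : Submodule F (Fin (n - 1) → F), Module.finrank F C' = K →
      minDist (C' : Set (Fin (n - 1) → F)) ≤ (n - 1) - K) (u : Fin n → F) :
    ∃ c ∈ C, hammingDist u c ≤ n - K - 1 := by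
  by_contra! hu
  obtain ⟨m, rfl⟩ : ∃ m, n = m + 1 := ⟨n - 1, by omega⟩
  have huC : u ∉ C := fun h => by simpa using hu u h
  have hfin : Module.finrank F (C ⊔ Submodule.span F {u} : Submodule F (Fin (m + 1) → F)) =
      K + 1 := by
    have hu0 : u ≠ 0 := fun h => huC (h ▸ C.zero_mem)
    have h := Submodule.finrank_sup_add_finrank_inf_eq C (Submodule.span F {u})
    have hdis : C ⊓ Submodule.span F {u} = ⊥ :=
      ((Submodule.disjoint_span_singleton' hu0).2 huC).eq_bot
    rwa [hdis, finrank_bot, finrank_span_singleton hu0, hC] at h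
  obtain ⟨C', hC', hd'⟩ := exists_shortened (d := m + 1 - K) hfin (by
    intro w hw hw0
    obtain ⟨c, hc, z, hz, rfl⟩ := Submodule.mem_sup.1 hw
    obtain ⟨a, rfl⟩ := Submodule.mem_span_singleton.1 hz
    by_cases ha : a = 0
    · subst ha
      rw [zero_smul, add_zero] at hw0 ⊢
      exact hd c hc hw0
    · have h := hu (-(a⁻¹ • c)) (C.neg_mem (C.smul_mem _ hc))
      rw [hammingDist_eq_hammingNorm] at h
      have heq : c + a • u = (-a) • (-u + -(a⁻¹ • c)) := by
        rw [← neg_add, smul_neg, neg_smul, neg_neg, smul_add, smul_inv_smul₀ ha]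
        exact add_comm c _
      rw [heq, hammingNorm_smul (fun _ => IsSMulRegular.of_ne_zero (neg_ne_zero.2 ha))]
      omega)
  have hmin := hmds C' hC'
  have hne : ((fun c => hammingDist c 0) '' ((C' : Set (Fin m → F)) \ {0})).Nonempty := by
    obtain ⟨c, hc, hc0⟩ := Submodule.exists_mem_ne_zero_of_ne_bot (p := C') (by
      rintro rfl
      rw [finrank_bot] at hC'
      omega)
    exact ⟨_, c, ⟨hc, hc0⟩, rfl⟩
  obtain ⟨c, ⟨hc, hc0⟩, hcd⟩ := Nat.sInf_mem hne
  have h1 := hd' c hc hc0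
  rw [← hammingDist_zero_right] at h1
  have h2 : hammingDist c 0 ≤ m - K := hcd.trans_le hmin
  omega

lemma hammingNorm_add_card_zeros (c : Fin n → F) :
    hammingNorm c + ({i | c i = 0} : Finset (Fin n)).card = n := by
  have h := Finset.card_filter_add_card_filter_not (s := (Finset.univ : Finset (Fin n)))
    (fun i => c i = 0)
  rw [Finset.card_univ, Fintype.card_fin] at h
  rw [hammingNorm, add_comm]
  exact h

end HammingDistance

end Codes

section EllipticCode

open Polynomial WeierstrassCurve.Affine WeierstrassCurve.Affine.CoordinateRing
open scoped Polynomial.Bivariate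

variable {F : Type*} [Field F] {n : ℕ}

lemma sum_mul_phiAff {k : ℕ} (hk : 1 ≤ k) (w : ℕ → F) (Q : F × F) :
    ∑ j : Fin k, w j * phiAff k Q j = ∑ j ∈ Finset.range (k / 2 + 1), w j * Q.1 ^ j +
      (∑ j ∈ Finset.range ((k - 1) / 2), w (k / 2 + 1 + j) * Q.1 ^ j) * Q.2 := by
  let g : ℕ → F := fun j => w j * if j ≤ k / 2 then Q.1 ^ j else Q.2 * Q.1 ^ (j - k / 2 - 1)
  have hg : ∑ j : Fin k, w j * phiAff k Q j = ∑ j ∈ Finset.range k, g j :=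
    Fin.sum_univ_eq_sum_range g k
  rw [hg, show Finset.range k = Finset.range (k / 2 + 1 + (k - 1) / 2) by congr 1; omega,
    Finset.sum_range_add, Finset.sum_mul]
  congr 1
  · refine Finset.sum_congr rfl fun j hj => ?_
    simp only [g]
    rw [if_pos (by have := Finset.mem_range.1 hj; omega)]
  · refine Finset.sum_congr rfl fun j _ => ?_
    simp only [g]
    rw [if_neg (by omega), show k / 2 + 1 + j - k / 2 - 1 = j by omega]
    ring

lemma exists_mem_degreeLT_eval_eq (m : ℕ) (w : ℕ → F) :
    ∃ p ∈ degreeLT F m, ∀ x : F, p.eval x = ∑ j ∈ Finset.range m, w j * x ^ j := by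
  refine ⟨∑ j ∈ Finset.range m, monomial j (w j), Submodule.sum_mem _ fun j hj => ?_,
    fun x => by simp [eval_finsetSum]⟩
  exact mem_degreeLT.2 ((degree_monomial_le _ _).trans_lt
    (Nat.cast_lt.2 (Finset.mem_range.1 hj)))

lemma eval_eq_sum_range_of_mem_degreeLT {m : ℕ} {p : F[X]} (hp : p ∈ degreeLT F m) (x : F) :
    p.eval x = ∑ j ∈ Finset.range m, p.coeff j * x ^ j := by
  rw [eval_eq_sum_degreeLTEquiv hp, ← Fin.sum_univ_eq_sum_range (fun j => p.coeff j * x ^ j)]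
  rfl

variable {W : WeierstrassCurve.Affine F} {P : Fin n → F × F}
  (h : ∀ i, W.Equation (P i).1 (P i).2)

lemma mem_funcSub {k : ℕ} (hk : 1 ≤ k) {c : Fin n → F} :
    c ∈ funcSub k P ↔ ∃ f ∈ rrSpace W k, evalPoints h f = c := by
  constructor
  · rintro ⟨u, rfl⟩
    let w : ℕ → F := fun j => if hj : j < k then u ⟨j, hj⟩ else 0
    obtain ⟨p, hp, hpe⟩ := exists_mem_degreeLT_eval_eq (k / 2 + 1) w
    obtain ⟨q, hq, hqe⟩ := exists_mem_degreeLT_eval_eq ((k - 1) / 2) fun j => w (k / 2 + 1 + j)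
    refine ⟨_, smul_basis_mem_rrSpace.2 ⟨hp, hq⟩, ?_⟩
    ext i
    rw [evalPoints_apply, evalPoint_smul_basis, hpe, hqe, ← sum_mul_phiAff hk]
    exact Finset.sum_congr rfl fun j _ => by simp [w, Hmat]
  · rintro ⟨f, hf, rfl⟩
    obtain ⟨p, q, rfl⟩ := exists_smul_basis_eq f
    obtain ⟨hp, hq⟩ := smul_basis_mem_rrSpace.1 hf
    let w : ℕ → F := fun j => if j ≤ k / 2 then p.coeff j else q.coeff (j - (k / 2 + 1))
    refine ⟨fun j => w j, ?_⟩
    ext i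
    rw [evalPoints_apply, evalPoint_smul_basis, eval_eq_sum_range_of_mem_degreeLT hp,
      eval_eq_sum_range_of_mem_degreeLT hq]
    refine (sum_mul_phiAff hk w (P i)).trans ?_
    congr 1
    · refine Finset.sum_congr rfl fun j hj => ?_
      simp only [w]
      rw [if_pos (by have := Finset.mem_range.1 hj; omega)]
    · congr 1
      refine Finset.sum_congr rfl fun j _ => ?_
      simp only [w]
      rw [if_neg (by omega), show k / 2 + 1 + j - (k / 2 + 1) = j by omega]

include h in
lemma funcSub_mono {k l : ℕ} (hk : 1 ≤ k) (hkl : k ≤ l) : funcSub k P ≤ funcSub l P := by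
  intro c hc
  obtain ⟨f, hf, rfl⟩ := (mem_funcSub h hk).1 hc
  exact (mem_funcSub h (hk.trans hkl)).2 ⟨f, rrSpace_mono hkl hf, rfl⟩

include h in
lemma resSub_anti {k l : ℕ} (hk : 1 ≤ k) (hkl : k ≤ l) : resSub l P ≤ resSub k P := fun _ hv =>
  mem_resSub.2 fun c hc => mem_resSub.1 hv c (funcSub_mono h hk hkl hc)

include h in
lemma finrank_funcSub (hP : Function.Injective P) {k : ℕ} (hk : 1 ≤ k) (hkn : k < n) :
    Module.finrank F (funcSub k P) = k := by
  have heq : funcSub k P = LinearMap.range ((evalPoints h).domRestrict (rrSpace W k)) := by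
    ext c
    rw [mem_funcSub h hk, LinearMap.mem_range]
    simp
  rw [heq, LinearMap.finrank_range_of_inj fun f g hfg => ?_, finrank_rrSpace hk]
  by_contra hne
  have hle := card_le_of_mem_rrSpace h hP (sub_ne_zero.2 fun hfg => hne (Subtype.ext hfg))
    ((LinearMap.map_sub _ f.1 g.1).trans (sub_eq_zero.2 hfg)) (sub_mem f.2 g.2)
  rw [Fintype.card_fin] at hle
  omega

include h in
lemma finrank_resSub (hP : Function.Injective P) {k : ℕ} (hk : 1 ≤ k) (hkn : k < n) :
    Module.finrank F (resSub k P) = n - k := by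
  have h1 := finrank_resSub_add k P
  rw [finrank_funcSub h hP hk hkn] at h1
  omega

variable [DecidableEq F]

include h in
lemma sub_le_hammingNorm_of_mem_funcSub (hP : Function.Injective P) {k : ℕ} (hk : 1 ≤ k)
    {c : Fin n → F} (hc : c ∈ funcSub k P) (hc0 : c ≠ 0) : n - k ≤ hammingNorm c := by
  obtain ⟨f, hf, rfl⟩ := (mem_funcSub h hk).1 hc
  have hf0 : f ≠ 0 := fun hf0 => hc0 (by rw [hf0, map_zero])
  have hle := card_le_of_mem_rrSpace (P := fun i : {i // evalPoints h f i = 0} => P i)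
    (fun i => h i) (hP.comp Subtype.val_injective) hf0 (funext fun i => i.2) hf
  rw [Fintype.card_subtype] at hle
  have := hammingNorm_add_card_zeros (evalPoints h f)
  omega

include h in
lemma le_hammingNorm_of_mem_resSub (hP : Function.Injective P) {k : ℕ} (hk : 1 ≤ k)
    {v : Fin n → F} (hv : v ∈ resSub k P) (hv0 : v ≠ 0) : k ≤ hammingNorm v := by
  by_contra! hlt
  obtain ⟨i, hi⟩ := Function.ne_iff.1 hv0
  obtain ⟨f, hf, hfe⟩ := exists_mem_rrSpace_evalPoints_eq (P := fun i : {i // v i ≠ 0} => P i)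
    (fun i => h i) (hP.comp Subtype.val_injective) (k := k)
    (by rwa [Fintype.card_subtype]) (Pi.single ⟨i, hi⟩ 1)
  have h0 := mem_resSub.1 hv _ ((mem_funcSub h hk).2 ⟨f, hf, rfl⟩)
  refine hi ?_
  rw [dotProduct, Finset.sum_eq_single i] at h0
  · have hfi := congrFun hfe ⟨i, hi⟩
    rw [Pi.single_eq_same] at hfi
    rwa [show evalPoints h f i = 1 from hfi, one_mul] at h0
  · intro j _ hj
    by_cases hvj : v j = 0
    · rw [hvj, mul_zero]
    · have hfj := congrFun hfe ⟨j, hvj⟩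
      rw [Pi.single_eq_of_ne (fun he => hj (congrArg Subtype.val he))] at hfj
      rw [show evalPoints h f j = 0 from hfj, zero_mul]
  · exact fun hi => (hi (Finset.mem_univ i)).elim

/-- If a nonzero word of the functional code vanishes on `k` coordinates, then the residue code
has a nonzero word supported on them. -/
lemma exists_mem_resSub_of_funcSub {k : ℕ} {S : Finset (Fin n)} (hS : S.card = k)
    {c : Fin n → F} (hc : c ∈ funcSub k P) (hc0 : c ≠ 0) (hcS : ∀ i ∈ S, c i = 0) :
    ∃ v ∈ resSub k P, v ≠ 0 ∧ hammingNorm v ≤ k := by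
  obtain ⟨u, rfl⟩ := hc
  have hu : u ≠ 0 := by
    rintro rfl
    exact hc0 (map_zero _)
  let e := S.orderEmbOfFin hS
  have he : Function.Injective e := e.injective
  have hdet : ((Hmat k P).submatrix id e).det = 0 :=
    exists_vecMul_eq_zero_iff.1 ⟨u, hu, funext fun j => hcS _ (S.orderEmbOfFin_mem hS j)⟩
  obtain ⟨v, hv0, hv⟩ := exists_mulVec_eq_zero_iff.2 hdet
  have hout : ∀ i ∉ S, Function.extend e v 0 i = 0 := fun i hi =>
    Function.extend_apply' _ _ _ fun ⟨j, hj⟩ => hi (hj ▸ S.orderEmbOfFin_mem hS j)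
  refine ⟨Function.extend e v 0, ?_, ?_, ?_⟩
  · rw [resSub, LinearMap.mem_ker, mulVecLin_apply]
    ext i
    rw [← hv, mulVec, mulVec, dotProduct, dotProduct]
    refine (Finset.sum_of_injOn e he.injOn (fun _ _ => Finset.mem_coe.2 (Finset.mem_univ _))
      (fun j _ hj => ?_) fun j _ => ?_).symm
    · rw [Function.extend_apply' _ _ _ fun ⟨l, hl⟩ => hj ⟨l, by simp, hl⟩]
      simp
    · rw [he.extend_apply]
      rfl
  · intro h0
    refine hv0 (funext fun j => ?_)
    rw [← he.extend_apply v 0 j, h0]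
    rfl
  · refine (Finset.card_le_card (t := S) fun i hi => ?_).trans hS.le
    by_contra hiS
    exact (Finset.mem_filter.1 hi).2 (hout i hiS)

include h in
lemma covRad_funcSub (hP : Function.Injective P) {k : ℕ} (hk : 1 ≤ k) (hkn : k + 1 < n)
    (hmds : ∀ C' : Submodule F (Fin (n - 1) → F), Module.finrank F C' = k →
      minDist (C' : Set (Fin (n - 1) → F)) ≤ (n - 1) - k) :
    covRad (funcSub k P : Set (Fin n → F)) = n - k - 1 := by
  refine covRad_eq (exists_hammingDist_le hk (by omega) (finrank_funcSub h hP hk (by omega))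
    (fun c hc hc0 => sub_le_hammingNorm_of_mem_funcSub h hP hk hc hc0) hmds) ?_
  have hlt : funcSub k P < funcSub (k + 1) P := by
    refine lt_of_le_of_ne (funcSub_mono h hk k.le_succ) fun heq => ?_
    have h1 := finrank_funcSub h hP hk (by omega)
    rw [heq, finrank_funcSub h hP (by omega) hkn] at h1
    omega
  obtain ⟨u, hu, huk⟩ := SetLike.exists_of_lt hlt
  refine ⟨u, fun c hc => ?_⟩
  rw [hammingDist_eq_hammingNorm, Nat.sub_sub]
  refine sub_le_hammingNorm_of_mem_funcSub h hP (by omega)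
    (add_mem (neg_mem hu) (hlt.le hc)) fun h0 => huk ?_
  rwa [neg_add_eq_zero.1 h0]

include h in
lemma covRad_resSub (hP : Function.Injective P) {k : ℕ} (hk : 2 ≤ k) (hkn : k < n)
    (hmds : ∀ C' : Submodule F (Fin (n - 1) → F), Module.finrank F C' = n - k →
      minDist (C' : Set (Fin (n - 1) → F)) ≤ (n - 1) - (n - k)) :
    covRad (resSub k P : Set (Fin n → F)) = k - 1 := by
  have hub := exists_hammingDist_le (by omega) (by omega)
    (finrank_resSub h hP (by omega : 1 ≤ k) hkn) (fun c hc hc0 =>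
      (by omega : n - (n - k) ≤ k).trans (le_hammingNorm_of_mem_resSub h hP (by omega) hc hc0)) hmds
  rw [Nat.sub_sub_self hkn.le] at hub
  refine covRad_eq hub ?_
  have hlt : resSub k P < resSub (k - 1) P := by
    refine lt_of_le_of_ne (resSub_anti h (by omega) (Nat.sub_le _ _)) fun heq => ?_
    have h1 := finrank_resSub h hP (by omega : 1 ≤ k) hkn
    rw [heq, finrank_resSub h hP (by omega) (by omega)] at h1
    omega
  obtain ⟨u, hu, huk⟩ := SetLike.exists_of_lt hlt
  refine ⟨u, fun c hc => ?_⟩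
  rw [hammingDist_eq_hammingNorm]
  refine le_hammingNorm_of_mem_resSub h hP (by omega)
    (add_mem (neg_mem hu) (hlt.le hc)) fun h0 => huk ?_
  rwa [neg_add_eq_zero.1 h0]

end EllipticCode

section LongCode

variable {F : Type*} [Field F] [Fintype F] [DecidableEq F] {n : ℕ}

lemma exists_mem_funcSub_vanishing (hq : Odd (Fintype.card F)) {s t : F}
    (hdisc : 4 * s ^ 3 + 27 * t ^ 2 ≠ 0) {P : Fin n → F × F} (hP : Function.Injective P)
    (hPcurve : ∀ i, onCurve s t (P i)) (hn : Fintype.card F + 3 ≤ n) {k : ℕ} (hk : 2 ≤ k)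
    (hkn : k + 2 ≤ n) :
    ∃ S : Finset (Fin n), S.card = k ∧ ∃ c ∈ funcSub k P, c ≠ 0 ∧ ∀ i ∈ S, c i = 0 := by
  have h : ∀ i, (shortCurve s t).Equation (P i).1 (P i).2 := fun i =>
    shortCurve_equation_iff.2 (hPcurve i)
  have hns : ∀ i, (shortCurve s t).Nonsingular (P i).1 (P i).2 := fun i =>
    (shortCurve_nonsingular_iff (two_ne_zero_of_odd_card hq) hdisc).2 (hPcurve i)
  let R : Fin n → (shortCurve s t).Point := fun i => .some _ _ (hns i)
  have hR : Function.Injective R := fun i j hij => by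
    obtain ⟨h1, h2⟩ := WeierstrassCurve.Affine.Point.some.inj hij
    exact hP (Prod.ext h1 h2)
  have hcard : (Finset.univ.image R).card = n := by
    rw [Finset.card_image_of_injective _ hR, Finset.card_fin]
  obtain ⟨A, hA, hAk, hA0⟩ := hasSubsetSum_zero_shortCurve hq hdisc (D := Finset.univ.image R)
    (fun h0 => by
      obtain ⟨i, -, hi⟩ := Finset.mem_image.1 h0
      exact WeierstrassCurve.Affine.Point.some_ne_zero _ hi)
    (hcard.symm ▸ hn) hk (hcard.symm ▸ hkn)
  obtain ⟨S, -, rfl⟩ := Finset.subset_image_iff.1 hA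
  rw [Finset.card_image_of_injective _ hR] at hAk
  rw [Finset.sum_image hR.injOn] at hA0
  obtain ⟨f, hf, hf0, hfS⟩ := exists_mem_rrSpace_of_sum_eq_zero (P := fun i : S => P i)
    (fun i => h i) (hP.comp Subtype.val_injective) (fun i => hns i)
    ((Finset.sum_coe_sort S R).trans hA0)
  rw [Fintype.card_coe, hAk] at hf
  refine ⟨S, hAk, evalPoints h f, (mem_funcSub h (by omega)).2 ⟨f, hf, rfl⟩, fun h0 => ?_,
    fun i hi => congrFun hfS ⟨i, hi⟩⟩
  have hle := card_le_of_mem_rrSpace h hP hf0 h0 hf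
  rw [Fintype.card_fin] at hle
  omega

end LongCode

/-- Suppose `|E(F_q)| ≥ q+4`, `n ≥ q+3`, `2 ≤ k ≤ n−2`, and `C` is
`C_Ω(D,kO)` or `C_L(D,kO)`. Then `d(C) = n − dim(C)`; and if moreover the MDS conjecture
holds for `[n−1, dim(C)]`-codes over `F_q` (every linear code of length `n−1` and dimension
`dim(C)` has minimum distance at most `(n−1) − dim(C)`), then `ρ(C) = n − dim(C) − 1`. -/
theorem min_dist_and_covering_radius_long_elliptic_code
    (F : Type) [Field F] [Fintype F] [DecidableEq F]
    (hq : Odd (Fintype.card F))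
    (s t : F) (hdisc : 4 * s ^ 3 + 27 * t ^ 2 ≠ 0)
    (hE : Fintype.card F + 4 ≤ numPoints F s t)
    {n : ℕ} (k : ℕ) (P : Fin n → F × F)
    (hPinj : Function.Injective P)
    (hPcurve : ∀ i, onCurve s t (P i))
    (hk2 : 2 ≤ k) (hkn : k ≤ n - 2)
    (hn : Fintype.card F + 3 ≤ n)
    (C : Set (Fin n → F)) (hC : C = resCode k P ∨ C = funcCode k P) :
    minDist C = n - dimCode F C ∧
      ((∀ C' : Submodule F (Fin (n - 1) → F), Module.finrank F C' = dimCode F C →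
          minDist (C' : Set (Fin (n - 1) → F)) ≤ (n - 1) - dimCode F C) →
        covRad C = n - dimCode F C - 1) := by
  have h : ∀ i, (shortCurve s t).Equation (P i).1 (P i).2 := fun i =>
    shortCurve_equation_iff.2 (hPcurve i)
  obtain ⟨S, hS, c, hc, hc0, hcS⟩ := exists_mem_funcSub_vanishing hq hdisc hPinj hPcurve hn hk2
    (by omega)
  rcases hC with rfl | rfl
  · rw [← coe_resSub, dimCode_coe, finrank_resSub h hPinj (by omega) (by omega),
      Nat.sub_sub_self (by omega)]
    exact ⟨minDist_eq (fun v => le_hammingNorm_of_mem_resSub h hPinj (by omega))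
      (exists_mem_resSub_of_funcSub hS hc hc0 hcS), covRad_resSub h hPinj hk2 (by omega)⟩
  · rw [← coe_funcSub, dimCode_coe, finrank_funcSub h hPinj (by omega) (by omega)]
    refine ⟨minDist_eq (fun v => sub_le_hammingNorm_of_mem_funcSub h hPinj (by omega))
      ⟨c, hc, hc0, ?_⟩, covRad_funcSub h hPinj (by omega) (by omega)⟩
    have h1 := hammingNorm_add_card_zeros c
    have h2 : S.card ≤ ({i | c i = 0} : Finset (Fin n)).card :=
      Finset.card_le_card fun i hi => Finset.mem_filter.2 ⟨Finset.mem_univ i, hcS i hi⟩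
    omega
end

section
/- Let F be a field, n ≥ 1, and α_1,…,α_n, β_1,…,β_n, α, β ∈ F. Let v ∈ F^n and set b = Σ_{i=1}^n v_i. Let m, m' be integers with m ≥ 0 and 0 ≤ m' ≤ m+1. Suppose Σ_{i=1}^n (α_i−α)·α_i^j·v_i = 0 for all 0 ≤ j ≤ m, and Σ_{i=1}^n α_i^j·(β_i−β)·v_i = 0 for all 0 ≤ j ≤ m'. Then Σ_{i=1}^n α_i^j·v_i = b·α^j for all 0 ≤ j ≤ m+1, and Σ_{i=1}^n α_i^j·β_i·v_i = b·β·α^j for all 0 ≤ j ≤ m'. (This is the row-reduction computation proving the syndrome formula H(k)vᵀ = b·(1, α, …, α^⌊k/2⌋, β, βα, …, βα^⌊(k−3)/2⌋)ᵀ in Theorem 3.6(3), with m = ⌊k/2⌋ and m' = ⌊(k−3)/2⌋.) -/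
open BigOperators

/-- The row-reduction computation behind the syndrome formula of
Theorem 3.6(3): if `Σ_i (α_i−α)·α_i^j·v_i = 0` for `0 ≤ j ≤ m` and
`Σ_i α_i^j·(β_i−β)·v_i = 0` for `0 ≤ j ≤ m'` with `m' ≤ m+1`, then, with `b = Σ_i v_i`,
`Σ_i α_i^j·v_i = b·α^j` for `0 ≤ j ≤ m+1` and `Σ_i α_i^j·β_i·v_i = b·β·α^j` for
`0 ≤ j ≤ m'`. -/
theorem syndrome_row_reduction
    (F : Type) [Field F] {n : ℕ} (hn : 1 ≤ n)
    (α β : F) (αs βs : Fin n → F) (v : Fin n → F)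
    (b : F) (hb : b = ∑ i, v i)
    (m m' : ℕ) (hm' : m' ≤ m + 1)
    (h1 : ∀ j ≤ m, ∑ i, (αs i - α) * αs i ^ j * v i = 0)
    (h2 : ∀ j ≤ m', ∑ i, αs i ^ j * (βs i - β) * v i = 0) :
    (∀ j ≤ m + 1, ∑ i, αs i ^ j * v i = b * α ^ j) ∧
      (∀ j ≤ m', ∑ i, αs i ^ j * βs i * v i = b * β * α ^ j) := by
  have power_sums : ∀ j ≤ m + 1, ∑ i, αs i ^ j * v i = b * α ^ j := by
    intro j
    induction j with
    | zero => simp [hb]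
    | succ j ih =>
      intro hj
      have hsplit : ∑ i, (αs i - α) * αs i ^ j * v i =
          ∑ i, αs i ^ (j + 1) * v i - α * ∑ i, αs i ^ j * v i := by
        rw [Finset.mul_sum, ← Finset.sum_sub_distrib]
        exact Finset.sum_congr rfl fun i _ => by ring
      rw [h1 j (by omega), ih (by omega)] at hsplit
      linear_combination -hsplit
  refine ⟨power_sums, fun j hj => ?_⟩
  have hsplit : ∑ i, αs i ^ j * (βs i - β) * v i =
      ∑ i, αs i ^ j * βs i * v i - β * ∑ i, αs i ^ j * v i := by
    rw [Finset.mul_sum, ← Finset.sum_sub_distrib]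
    exact Finset.sum_congr rfl fun i _ => by ring
  rw [h2 j hj, power_sums j (hj.trans hm')] at hsplit
  linear_combination -hsplit
end

section
/- Let 2 ≤ k ≤ n−2 and let ε = {φ_k(P) : P ∈ E(F_q)} ⊆ F_q^k. Suppose there is an integer N_0 with n ≥ N_0 such that every track T in PG(k−1,q) (a set of pairwise non-proportional nonzero vectors of F_q^k such that every k−1 of them are linearly independent and some k of them are linearly dependent) having at least N_0 of its points proportional to vectors of ε consists entirely of points proportional to vectors of ε. Suppose further that the residue elliptic code C = C_Ω(D,kO) has minimum distance exactly k (near-MDS) and covering radius k−1. Then a word v ∈ F_q^n is a deep hole of C if and only if H(k)vᵀ = c·φ_k(P) for some P ∈ E(F_q)∖D and some nonzero c ∈ F_q. -/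
open Matrix BigOperators

/-- A (finite) track in `PG(k−1,q)`: pairwise non-proportional nonzero vectors of `F_q^k`
such that every `k−1` of them are linearly independent and some `k` of them are linearly
dependent. -/
def IsTrack {F : Type*} [Field F] (k : ℕ) (T : Finset (Fin k → F)) : Prop :=
  (0 : Fin k → F) ∉ T ∧
  (∀ w ∈ T, ∀ w' ∈ T, w ≠ w' → ∀ c : F, w ≠ c • w') ∧
  (∀ S ⊆ T, S.card = k - 1 →
    LinearIndependent F (fun x : {x // x ∈ S} => (x : Fin k → F))) ∧
  (∃ S ⊆ T, S.card = k ∧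
    ¬ LinearIndependent F (fun x : {x // x ∈ S} => (x : Fin k → F)))

namespace EllipticArc

open Polynomial

variable {F : Type*} [Field F]

/-- Two functions `a₁ + b₁ y`, `a₂ + b₂ y` vanishing on a finite set `S` of affine points have a
determinant `a₁ b₂ - a₂ b₁` that is either zero or of degree at least `#S`. -/
lemma card_le_natDegree_det [DecidableEq F] {s t : F} {S : Finset (F × F)}
    (hS : ∀ p ∈ S, onCurve s t p) {a₁ b₁ a₂ b₂ : F[X]}
    (h₁ : ∀ p ∈ S, a₁.eval p.1 + p.2 * b₁.eval p.1 = 0)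
    (h₂ : ∀ p ∈ S, a₂.eval p.1 + p.2 * b₂.eval p.1 = 0)
    (hne : a₁ * b₂ - a₂ * b₁ ≠ 0) : S.card ≤ (a₁ * b₂ - a₂ * b₁).natDegree := by
  have key : S.val.map Prod.fst ≤ (a₁ * b₂ - a₂ * b₁).roots := by
    rw [Multiset.le_iff_count]
    intro α
    rw [count_roots, Multiset.count_map, le_rootMultiplicity_iff hne]
    have hcard : (Multiset.filter (fun p : F × F => α = p.1) S.val).card
        = (S.filter (fun p => α = p.1)).card := rfl
    rw [hcard]
    set T := S.filter (fun p => α = p.1) with hT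
    have hmem : ∀ p ∈ T, p ∈ S ∧ α = p.1 := fun p hp => by simpa [hT] using hp
    have hle : T.card ≤ 2 := by
      by_contra! h
      obtain ⟨p, q, r, hp, hq, hr, hpq, hpr, hqr⟩ := Finset.two_lt_card_iff.1 h
      obtain ⟨hpS, hpα⟩ := hmem p hp
      obtain ⟨hqS, hqα⟩ := hmem q hq
      obtain ⟨hrS, hrα⟩ := hmem r hr
      have e1 := hS p hpS
      have e2 := hS q hqS
      have e3 := hS r hrS
      simp only [onCurve, ← hpα, ← hqα, ← hrα] at e1 e2 e3
      have n1 : p.2 - q.2 ≠ 0 := fun h => hpq (Prod.ext (hpα ▸ hqα) (sub_eq_zero.1 h))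
      have n2 : p.2 - r.2 ≠ 0 := fun h => hpr (Prod.ext (hpα ▸ hrα) (sub_eq_zero.1 h))
      have f1 : p.2 + q.2 = 0 := by
        apply (mul_eq_zero.1 (show (p.2 - q.2) * (p.2 + q.2) = 0 by linear_combination e1 - e2)
          ).resolve_left n1
      have f2 : p.2 + r.2 = 0 := by
        apply (mul_eq_zero.1 (show (p.2 - r.2) * (p.2 + r.2) = 0 by linear_combination e1 - e3)
          ).resolve_left n2
      exact hqr (Prod.ext (hqα ▸ hrα) (by linear_combination f1 - f2))
    have hcases : T.card = 0 ∨ T.card = 1 ∨ T.card = 2 := by omega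
    rcases hcases with h | h | h
    · simp [h]
    · obtain ⟨p, hp⟩ := Finset.card_pos.1 (by omega : 0 < T.card)
      obtain ⟨hpS, hpα⟩ := hmem p hp
      have e1 := h₁ p hpS
      have e2 := h₂ p hpS
      rw [← hpα] at e1 e2
      rw [h, pow_one, dvd_iff_isRoot, IsRoot.def]
      simp only [eval_sub, eval_mul]
      linear_combination b₂.eval α * e1 - b₁.eval α * e2
    · obtain ⟨p, hp, q, hq, hpq⟩ := Finset.one_lt_card.1 (by omega : 1 < T.card)
      obtain ⟨hpS, hpα⟩ := hmem p hp
      obtain ⟨hqS, hqα⟩ := hmem q hq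
      have n1 : p.2 - q.2 ≠ 0 := fun h => hpq (Prod.ext (hpα ▸ hqα) (sub_eq_zero.1 h))
      have both : ∀ a b : F[X], (∀ p ∈ S, a.eval p.1 + p.2 * b.eval p.1 = 0) →
          X - C α ∣ a ∧ X - C α ∣ b := by
        intro a b hab
        have e1 := hab p hpS
        have e2 := hab q hqS
        rw [← hpα] at e1
        rw [← hqα] at e2
        have hb : b.eval α = 0 :=
          (mul_eq_zero.1 (show (p.2 - q.2) * b.eval α = 0 by linear_combination e1 - e2)
            ).resolve_left n1
        rw [hb, mul_zero, add_zero] at e1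
        exact ⟨dvd_iff_isRoot.2 e1, dvd_iff_isRoot.2 hb⟩
      obtain ⟨ha1, hb1⟩ := both _ _ h₁
      obtain ⟨ha2, hb2⟩ := both _ _ h₂
      rw [h, pow_two]
      exact dvd_sub (mul_dvd_mul ha1 hb2) (mul_dvd_mul ha2 hb1)
  calc S.card = (S.val.map Prod.fst).card := by simp
    _ ≤ _ := Multiset.card_le_card key
    _ ≤ _ := card_roots' _

/-- A nonzero function `a + b y` has at least as large a pole order at infinity as it has affine
zeros. -/
lemma card_le_poleOrder [DecidableEq F] {s t : F} {S : Finset (F × F)}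
    (hS : ∀ p ∈ S, onCurve s t p) {a b : F[X]} (hab : a ≠ 0 ∨ b ≠ 0)
    (h : ∀ p ∈ S, a.eval p.1 + p.2 * b.eval p.1 = 0) :
    S.card ≤ 2 * a.natDegree ∨ (b ≠ 0 ∧ S.card ≤ 2 * b.natDegree + 3) := by
  set c : F[X] := X ^ 3 + C s * X + C t with hc
  have hcdeg : c.natDegree = 3 := by rw [hc]; compute_degree!
  have hc0 : c ≠ 0 := fun h0 => by simp [h0] at hcdeg
  have hdega : (a * a).natDegree = 2 * a.natDegree := by rw [← pow_two, natDegree_pow]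
  have hdegb : b ≠ 0 → (c * b * b).natDegree = 2 * b.natDegree + 3 := fun h0 => by
    rw [natDegree_mul (mul_ne_zero hc0 h0) h0, natDegree_mul hc0 h0, hcdeg]
    ring
  have hne : a * a - (c * b) * b ≠ 0 := by
    intro h0
    have heq := sub_eq_zero.1 h0
    by_cases hb : b = 0
    · simp [hb] at heq
      tauto
    · have := congrArg natDegree heq
      rw [hdega, hdegb hb] at this
      omega
  have hle := card_le_natDegree_det (a₁ := a) (b₁ := b) (a₂ := c * b) (b₂ := a) hS h
    (fun p hp => by
      have e := hS p hp
      simp only [onCurve] at e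
      simp only [hc, eval_mul, eval_add, eval_pow, eval_X, eval_C]
      linear_combination p.2 * h p hp - b.eval p.1 * e) hne
  by_cases hb : b = 0
  · left
    simpa [hb, hdega] using hle
  · have h2 := natDegree_sub_le (a * a) (c * b * b)
    rw [hdega, hdegb hb] at h2
    have h3 := hle.trans h2
    rcases le_max_iff.1 h3 with h4 | h4
    · exact Or.inl h4
    · exact Or.inr ⟨hb, h4⟩

/-- There is no pencil of functions of pole order at most `m` vanishing at `m - 1` given affine
points: one cannot annihilate the coefficient of any prescribed pole order. -/
lemma no_pencil [DecidableEq F] {s t : F} {m : ℕ} (hm : 2 ≤ m) {S : Finset (F × F)}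
    (hS : ∀ p ∈ S, onCurve s t p) (hcard : S.card + 1 = m)
    (H : ∀ r : ℕ, ∃ a b : F[X], (a ≠ 0 ∨ b ≠ 0) ∧
      (∀ p ∈ S, a.eval p.1 + p.2 * b.eval p.1 = 0) ∧
      (∀ i, m < 2 * i ∨ 2 * i = r → a.coeff i = 0) ∧
      (∀ i, m < 2 * i + 3 ∨ 2 * i + 3 = r → b.coeff i = 0)) : False := by
  have H' : ∀ r : ℕ, ∃ a b : F[X],
      (∀ p ∈ S, a.eval p.1 + p.2 * b.eval p.1 = 0) ∧
      (a ≠ 0 → 2 * a.natDegree ≤ m ∧ 2 * a.natDegree ≠ r) ∧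
      (b ≠ 0 → 2 * b.natDegree + 3 ≤ m ∧ 2 * b.natDegree + 3 ≠ r) ∧
      ((a ≠ 0 ∧ m ≤ 2 * a.natDegree + 1) ∨ (b ≠ 0 ∧ m ≤ 2 * b.natDegree + 3 + 1)) := by
    intro r
    obtain ⟨a, b, hab, hv, ha, hb⟩ := H r
    refine ⟨a, b, hv, fun h0 => ?_, fun h0 => ?_, ?_⟩
    · have h1 : a.coeff a.natDegree ≠ 0 := by simpa using h0
      have h2 := mt (ha a.natDegree) h1
      omega
    · have h1 : b.coeff b.natDegree ≠ 0 := by simpa using h0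
      have h2 := mt (hb b.natDegree) h1
      omega
    · rcases card_le_poleOrder hS hab hv with h | ⟨h0, h⟩
      · refine Or.inl ⟨fun h0 => ?_, by omega⟩
        simp [h0] at h
        simp [h] at hcard
        omega
      · exact Or.inr ⟨h0, by omega⟩
  obtain ⟨a₁, b₁, hv₁, ha₁, hb₁, hor₁⟩ := H' m
  obtain ⟨a₂, b₂, hv₂, ha₂, hb₂, hor₂⟩ := H' (m - 1)
  have hlead : ∀ p q : F[X], q ≠ 0 → (p ≠ 0 → p.natDegree < q.natDegree) →
      q.natDegree + 2 ≤ m → p - q ≠ 0 ∧ (p - q).natDegree + 2 ≤ m := by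
    intro p q hq hp hqm
    by_cases h0 : p = 0
    · simpa [h0, hq] using hqm
    · have hlt := hp h0
      refine ⟨fun h => hlt.ne (by rw [sub_eq_zero.1 h]), ?_⟩
      rwa [natDegree_sub_eq_right_of_natDegree_lt hlt]
  have hmain : a₁ * b₂ - a₂ * b₁ ≠ 0 ∧ (a₁ * b₂ - a₂ * b₁).natDegree + 2 ≤ m := by
    rcases Nat.even_or_odd' m with ⟨l, hl | hl⟩
    · have hb : b₁ ≠ 0 := by grind
      have ha : a₂ ≠ 0 := by grind
      have eb : 2 * b₁.natDegree + 4 = m := by grind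
      have ea : 2 * a₂.natDegree = m := by grind
      have e := natDegree_mul ha hb
      refine hlead _ _ (mul_ne_zero ha hb) (fun h => ?_) (by omega)
      have h1 := left_ne_zero_of_mul h
      have h2 := right_ne_zero_of_mul h
      have := ha₁ h1
      have := hb₂ h2
      rw [natDegree_mul h1 h2]
      omega
    · have ha : a₁ ≠ 0 := by grind
      have hb : b₂ ≠ 0 := by grind
      have ea : 2 * a₁.natDegree + 1 = m := by grind
      have eb : 2 * b₂.natDegree + 3 = m := by grind
      have e := natDegree_mul ha hb
      rw [← neg_sub (a₂ * b₁), neg_ne_zero, natDegree_neg]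
      refine hlead _ _ (mul_ne_zero ha hb) (fun h => ?_) (by omega)
      have h1 := left_ne_zero_of_mul h
      have h2 := right_ne_zero_of_mul h
      have := ha₂ h1
      have := hb₁ h2
      rw [natDegree_mul h1 h2]
      omega
  have := card_le_natDegree_det hS hv₁ hv₂ hmain.1
  omega

/-- The polynomial `a` in the function `a + b y ∈ L(kO)` with coordinate vector `u`. -/
noncomputable def xPart (k : ℕ) (u : Fin k → F) : F[X] :=
  ∑ j : Fin k, if (j : ℕ) ≤ k / 2 then monomial (j : ℕ) (u j) else 0

/-- The polynomial `b` in the function `a + b y ∈ L(kO)` with coordinate vector `u`. -/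
noncomputable def yPart (k : ℕ) (u : Fin k → F) : F[X] :=
  ∑ j : Fin k, if (j : ℕ) ≤ k / 2 then 0 else monomial ((j : ℕ) - k / 2 - 1) (u j)

/-- The pole order at `O` of the `j`-th monomial. -/
def poleOrder (k j : ℕ) : ℕ := if j ≤ k / 2 then 2 * j else 2 * (j - k / 2 - 1) + 3

lemma eval_parts (k : ℕ) (u : Fin k → F) (p : F × F) :
    (xPart k u).eval p.1 + p.2 * (yPart k u).eval p.1 = u ⬝ᵥ phiAff k p := by
  simp only [xPart, yPart, eval_finsetSum, Finset.mul_sum, ← Finset.sum_add_distrib, dotProduct]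
  refine Finset.sum_congr rfl fun j _ => ?_
  unfold phiAff
  split_ifs <;> simp
  ring

lemma xPart_coeff_eq_zero {k i : ℕ} {u : Fin k → F}
    (h : ∀ j : Fin k, poleOrder k j = 2 * i → u j = 0) : (xPart k u).coeff i = 0 := by
  rw [xPart, finsetSum_coeff]
  refine Finset.sum_eq_zero fun j _ => ?_
  split_ifs with hj
  · rw [coeff_monomial]
    split_ifs with hji
    · exact h j (by rw [poleOrder, if_pos hj, hji])
    · rfl
  · simp

lemma yPart_coeff_eq_zero {k i : ℕ} {u : Fin k → F}
    (h : ∀ j : Fin k, poleOrder k j = 2 * i + 3 → u j = 0) : (yPart k u).coeff i = 0 := by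
  rw [yPart, finsetSum_coeff]
  refine Finset.sum_eq_zero fun j _ => ?_
  split_ifs with hj
  · simp
  · rw [coeff_monomial]
    split_ifs with hji
    · exact h j (by rw [poleOrder, if_neg hj, hji])
    · rfl

lemma xPart_coeff {k : ℕ} (u : Fin k → F) (j : Fin k) (hj : (j : ℕ) ≤ k / 2) :
    (xPart k u).coeff j = u j := by
  rw [xPart, finsetSum_coeff, Finset.sum_eq_single j]
  · simp [hj]
  · intro i _ hij
    have : (i : ℕ) ≠ j := fun h => hij (Fin.ext h)
    split_ifs <;> simp [coeff_monomial, this]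
  · simp

lemma yPart_coeff {k : ℕ} (u : Fin k → F) (j : Fin k) (hj : ¬ (j : ℕ) ≤ k / 2) :
    (yPart k u).coeff ((j : ℕ) - k / 2 - 1) = u j := by
  rw [yPart, finsetSum_coeff, Finset.sum_eq_single j]
  · simp [hj]
  · intro i _ hij
    have : (i : ℕ) ≠ j := fun h => hij (Fin.ext h)
    split_ifs with hi
    · simp
    · rw [coeff_monomial, if_neg (by omega)]
  · simp

lemma parts_ne_zero {k : ℕ} {u : Fin k → F} (hu : u ≠ 0) : xPart k u ≠ 0 ∨ yPart k u ≠ 0 := by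
  by_contra! h
  refine hu (funext fun j => ?_)
  by_cases hj : (j : ℕ) ≤ k / 2
  · rw [← xPart_coeff u j hj, h.1]; simp
  · rw [← yPart_coeff u j hj, h.2]; simp

lemma poleOrder_injective {k : ℕ} {i j : Fin k} (h : poleOrder k i = poleOrder k j) : i = j := by
  unfold poleOrder at h
  ext
  split_ifs at h <;> omega

lemma poleOrder_le {k : ℕ} (j : Fin k) : poleOrder k j ≤ k := by
  unfold poleOrder
  split_ifs <;> omega

lemma exists_vanishing {k : ℕ} {S : Finset (F × F)} (hS : S.card + 1 < k) (r : ℕ) :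
    ∃ u : Fin k → F, u ≠ 0 ∧ (∀ p ∈ S, u ⬝ᵥ phiAff k p = 0) ∧
      ∀ j : Fin k, poleOrder k j = r → u j = 0 := by
  obtain ⟨l, hl⟩ : ∃ l : (Fin k → F) →ₗ[F] F, ∀ u, l u = 0 →
      ∀ j : Fin k, poleOrder k j = r → u j = 0 := by
    by_cases h : ∃ j : Fin k, poleOrder k j = r
    · obtain ⟨j, hj⟩ := h
      refine ⟨LinearMap.proj j, fun u hu i hi => ?_⟩
      rwa [poleOrder_injective (hi.trans hj.symm)]
    · exact ⟨0, fun u _ j hj => absurd ⟨j, hj⟩ h⟩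
  let f : (Fin k → F) →ₗ[F] (S → F) × F :=
    (LinearMap.pi fun p : S => (dotProductBilin F F).flip (phiAff k p.1)).prod l
  have hker : LinearMap.ker f ≠ ⊥ := LinearMap.ker_ne_bot_of_finrank_lt (by simpa using hS)
  obtain ⟨u, hu, hu0⟩ := (Submodule.ne_bot_iff _).1 hker
  have hfu : f u = 0 := hu
  refine ⟨u, hu0, fun p hp => ?_, hl u (congrArg Prod.snd hfu)⟩
  exact congrFun (congrArg Prod.fst hfu) ⟨p, hp⟩

/-- `k - 2` affine points and a further affine point impose independent conditions on `L(kO)`. -/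
lemma exists_separating_affine [DecidableEq F] {s t : F} {k : ℕ} {S : Finset (F × F)}
    (hS : ∀ p ∈ S, onCurve s t p) (hcard : S.card + 2 = k) {Q : F × F} (hQ : onCurve s t Q)
    (hQS : Q ∉ S) :
    ∃ u : Fin k → F, (∀ p ∈ S, u ⬝ᵥ phiAff k p = 0) ∧ u ⬝ᵥ phiAff k Q ≠ 0 := by
  by_contra! hcon
  refine no_pencil (m := k) (by omega) (S := insert Q S) (s := s) (t := t) ?_ ?_ fun r => ?_
  · exact (Finset.forall_mem_insert _ _ _).2 ⟨hQ, hS⟩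
  · rw [Finset.card_insert_of_notMem hQS]; omega
  · obtain ⟨u, hu, hv, hr⟩ := exists_vanishing (k := k) (S := S) (by omega) r
    refine ⟨xPart k u, yPart k u, parts_ne_zero hu, fun p hp => ?_, fun i hi => ?_, fun i hi => ?_⟩
    · rw [eval_parts]
      rcases Finset.mem_insert.1 hp with rfl | hp
      · exact hcon u hv
      · exact hv p hp
    · refine xPart_coeff_eq_zero fun j hj => ?_
      have := poleOrder_le j
      exact hr j (by omega)
    · refine yPart_coeff_eq_zero fun j hj => ?_
      have := poleOrder_le j
      exact hr j (by omega)

/-- `k - 2` affine points and the point at infinity impose independent conditions on `L(kO)`. -/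
lemma exists_separating_infinity [DecidableEq F] {s t : F} {k : ℕ} (hk : 3 ≤ k)
    {S : Finset (F × F)} (hS : ∀ p ∈ S, onCurve s t p) (hcard : S.card + 2 = k) :
    ∃ u : Fin k → F, (∀ p ∈ S, u ⬝ᵥ phiAff k p = 0) ∧ u ⬝ᵥ phiInf F k ≠ 0 := by
  by_contra! hcon
  refine no_pencil (m := k - 1) (by omega) hS (by omega) fun r => ?_
  obtain ⟨u, hu, hv, hr⟩ := exists_vanishing (k := k) (S := S) (by omega) r
  have htop : ∀ j : Fin k, poleOrder k j = k → u j = 0 := by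
    intro j hj
    have h0 := hcon u hv
    have hjt : (j : ℕ) = if k % 2 = 0 then k / 2 else k - 1 := by
      unfold poleOrder at hj
      split_ifs at hj ⊢ <;> omega
    have hphi : phiInf F k = Pi.single j 1 := by
      funext i
      simp only [phiInf, ← hjt, Pi.single_apply, Fin.ext_iff]
    simpa [hphi] using h0
  have hzero : ∀ j : Fin k, k - 1 < poleOrder k j ∨ poleOrder k j = r → u j = 0 := by
    rintro j (hj | hj)
    · have := poleOrder_le j
      exact htop j (by omega)
    · exact hr j hj
  refine ⟨xPart k u, yPart k u, parts_ne_zero hu, fun p hp => ?_, fun i hi => ?_, fun i hi => ?_⟩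
  · rw [eval_parts]
    exact hv p hp
  · exact xPart_coeff_eq_zero fun j hj => hzero j (by rwa [hj])
  · exact yPart_coeff_eq_zero fun j hj => hzero j (by rwa [hj])

/-- If every nontrivial relation of a family involves at least `k ≥ 3` members and some relation
involves exactly `k`, then the family is injective and its members form a track. -/
lemma isTrack_of_relations [DecidableEq F] {ι : Type*} [Fintype ι] [DecidableEq ι] {k : ℕ}
    (hk : 3 ≤ k) (g : ι → Fin k → F)
    (h : ∀ y : ι → F, y ≠ 0 → ∑ i, y i • g i = 0 → k ≤ hammingNorm y)
    (h' : ∃ y : ι → F, hammingNorm y = k ∧ ∑ i, y i • g i = 0) :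
    Function.Injective g ∧ IsTrack k (Finset.univ.image g) := by
  have hind : ∀ J : Finset ι, J.card < k → LinearIndepOn F g (J : Set ι) := by
    intro J hJ
    rw [linearIndepOn_finset_iff]
    intro f hf
    by_contra! hne
    obtain ⟨i, hi, hfi⟩ := hne
    have hle := h (fun i => if i ∈ J then f i else 0)
      (fun h0 => hfi (by simpa [hi] using congrFun h0 i)) (by simpa [ite_smul] using hf)
    have : hammingNorm (fun i => if i ∈ J then f i else 0) ≤ J.card := by
      refine Finset.card_le_card fun i hi => ?_
      simp at hi
      exact hi.1
    omega
  have hprop : ∀ i j, i ≠ j → ∀ c : F, g i ≠ c • g j := by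
    intro i j hij c hc
    have hl := linearIndepOn_finset_iff.1
      (hind {i, j} (lt_of_le_of_lt Finset.card_le_two (by omega)))
      (fun l => if l = i then 1 else -c)
      (by rw [Finset.sum_pair hij]; simp [hij.symm, hc]) i (by simp)
    simp at hl
  have hinj : Function.Injective g := fun i j hij => by
    by_contra hne
    exact hprop i j hne 1 (by simpa using hij)
  refine ⟨hinj, ?_, ?_, ?_, ?_⟩
  · intro h0
    obtain ⟨i, -, hi⟩ := Finset.mem_image.1 h0
    exact (hind {i} (by simp; omega)).ne_zero (by simp) hi
  · intro w hw w' hw' hne c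
    obtain ⟨i, -, rfl⟩ := Finset.mem_image.1 hw
    obtain ⟨j, -, rfl⟩ := Finset.mem_image.1 hw'
    exact hprop i j (fun h => hne (h ▸ rfl)) c
  · intro S hS hSc
    obtain ⟨J, -, rfl⟩ := Finset.subset_image_iff.1 hS
    rw [Finset.card_image_of_injective _ hinj] at hSc
    have := (hind J (by omega)).id_image
    rw [← Finset.coe_image] at this
    exact this
  · obtain ⟨y, hy, hy0⟩ := h'
    refine ⟨(Finset.univ.filter fun i => y i ≠ 0).image g,
      Finset.image_subset_image (Finset.subset_univ _), ?_, fun hli => ?_⟩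
    · rw [Finset.card_image_of_injective _ hinj]
      exact hy
    · have hli' : LinearIndepOn F g (Finset.univ.filter fun i => y i ≠ 0 : Finset ι) := by
        rw [linearIndepOn_iff_image hinj.injOn, ← Finset.coe_image]
        exact hli
      have h0 := linearIndepOn_finset_iff.1 hli' y
        (by rw [← hy0]; exact Finset.sum_filter_of_ne fun i _ hi h0 => hi (by simp [h0]))
      have : hammingNorm y = 0 := by
        rw [hammingNorm_eq_zero]
        funext i
        by_contra hi
        exact hi (h0 i (by simpa using hi))
      omega


lemma mulVec_Hmat {n : ℕ} (k : ℕ) (P : Fin n → F × F) (x : Fin n → F) :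
    Hmat k P *ᵥ x = ∑ i, x i • phiAff k (P i) := by
  funext j
  simp [Matrix.mulVec, dotProduct, Hmat, mul_comm]

lemma dTo_le [DecidableEq F] {n k : ℕ} {P : Fin n → F × F} {v x : Fin n → F}
    (h : Hmat k P *ᵥ x = Hmat k P *ᵥ v) : dTo v (resCode k P) ≤ hammingNorm x := by
  refine Nat.sInf_le ⟨v - x, ?_, ?_⟩
  · simp [resCode, Matrix.mulVec_sub, h]
  · rw [hammingDist_comm, hammingDist_eq_hammingNorm]
    simp

lemma exists_hammingNorm_eq_dTo [DecidableEq F] {n : ℕ} (k : ℕ) (P : Fin n → F × F)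
    (v : Fin n → F) :
    ∃ x, Hmat k P *ᵥ x = Hmat k P *ᵥ v ∧ hammingNorm x = dTo v (resCode k P) := by
  obtain ⟨c, hc, hvc⟩ := Nat.sInf_mem (s := hammingDist v '' resCode k P)
    ⟨_, 0, by simp [resCode], rfl⟩
  refine ⟨v - c, ?_, ?_⟩
  · have hc' : Hmat k P *ᵥ c = 0 := hc
    rw [Matrix.mulVec_sub, hc', sub_zero]
  · rw [← neg_add_eq_sub, ← hammingDist_eq_hammingNorm, hammingDist_comm]
    exact hvc

lemma dTo_le_covRad {F : Type*} [Fintype F] [DecidableEq F] {n : ℕ} (C : Set (Fin n → F)) (v : Fin n → F) :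
    dTo v C ≤ covRad C :=
  le_csSup (Set.finite_range _).bddAbove ⟨v, rfl⟩

/-- For `k = 2` the covering radius exceeds `1`, since no column is proportional to `(0, 1)`. -/
lemma one_lt_covRad_two [Fintype F] [DecidableEq F] {s t : F} {n : ℕ} {P : Fin n → F × F}
    (hPinj : Function.Injective P) (hP : ∀ i, onCurve s t (P i)) (hn : 3 ≤ n) :
    1 < covRad (resCode 2 P) := by
  obtain ⟨i, j, hij⟩ : ∃ i j, (P i).1 ≠ (P j).1 := by
    by_contra! hcon
    have hsq : ∀ i j, i ≠ j → (P i).2 + (P j).2 = 0 := by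
      intro i j hij
      have e1 := hP i
      have e2 := hP j
      simp only [onCurve, hcon i j] at e1 e2
      have hne : (P i).2 - (P j).2 ≠ 0 := fun h =>
        hij (hPinj (Prod.ext (hcon i j) (sub_eq_zero.1 h)))
      exact (mul_eq_zero.1 (show ((P i).2 - (P j).2) * ((P i).2 + (P j).2) = 0 by
        linear_combination e1 - e2)).resolve_left hne
    have h1 := hsq ⟨0, by omega⟩ ⟨1, by omega⟩ (by simp)
    have h2 := hsq ⟨0, by omega⟩ ⟨2, by omega⟩ (by simp)
    have h3 := hPinj (Prod.ext (hcon ⟨1, by omega⟩ ⟨2, by omega⟩) (by linear_combination h1 - h2))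
    simp at h3
  by_contra! hle
  obtain ⟨x, hx, hxn⟩ := exists_hammingNorm_eq_dTo 2 P (Pi.single i 1 - Pi.single j 1)
  have hx1 : hammingNorm x ≤ 1 := hxn.le.trans ((dTo_le_covRad _ _).trans hle)
  have hsupp : ∀ l m, x l ≠ 0 → x m ≠ 0 → l = m := fun l m hl hm =>
    Finset.card_le_one.1 hx1 l (by simpa using hl) m (by simpa using hm)
  rw [Matrix.mulVec_sub, mulVec_Hmat, Matrix.mulVec_single_one, Matrix.mulVec_single_one] at hx
  have hx0 := congrFun hx 0
  have hx1 := congrFun hx 1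
  simp [Hmat, phiAff] at hx0 hx1
  have hzero : ∀ l, x l = 0 := by
    intro l
    by_contra hl
    refine hl ?_
    rw [← hx0]
    refine (Finset.sum_eq_single l (fun m _ hm => ?_) (by simp)).symm
    by_contra hm0
    exact hm (hsupp m l hm0 hl)
  simp [hzero] at hx1
  exact hij (sub_eq_zero.1 hx1.symm)

/-- A syndrome separated from every `k - 2` columns is not a combination of `k - 2` columns. -/
lemma le_hammingNorm_of_separating [DecidableEq F] {n k : ℕ} {P : Fin n → F × F}
    (hPinj : Function.Injective P) (hk : 2 ≤ k) (hkn : k ≤ n - 2) {w : Fin k → F}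
    (hw : ∀ J : Finset (Fin n), (J.image P).card + 2 = k →
      ∃ u : Fin k → F, (∀ p ∈ J.image P, u ⬝ᵥ phiAff k p = 0) ∧ u ⬝ᵥ w ≠ 0)
    {x : Fin n → F} (hx : Hmat k P *ᵥ x = w) : k - 1 ≤ hammingNorm x := by
  by_contra! hlt
  obtain ⟨J, hJ, -, hJc⟩ := Finset.exists_subsuperset_card_eq
    (s := Finset.univ.filter fun i => x i ≠ 0) (n := k - 2) (Finset.subset_univ _)
    (by change hammingNorm x ≤ _; omega) (by simp; omega)
  obtain ⟨u, hu, huw⟩ := hw J (by rw [Finset.card_image_of_injective _ hPinj]; omega)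
  refine huw ?_
  rw [← hx, mulVec_Hmat, dotProduct_sum]
  refine Finset.sum_eq_zero fun i _ => ?_
  by_cases hi : x i = 0
  · simp [hi]
  · rw [dotProduct_smul, hu _ (Finset.mem_image_of_mem _ (hJ (by simpa using hi))), smul_zero]

/-- Adjoining the syndrome of a word at distance at least `k - 1` to the columns of the
parity-check matrix of a near-MDS code yields a track. -/
lemma isTrack_insert_syndrome [DecidableEq F] {n k : ℕ} {P : Fin n → F × F} (hk : 3 ≤ k)
    (hd : minDist (resCode k P) = k) {v : Fin n → F} (hv : k - 1 ≤ dTo v (resCode k P)) :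
    let g : Option (Fin n) → Fin k → F :=
      fun o => o.elim (Hmat k P *ᵥ v) fun i => phiAff k (P i)
    Function.Injective g ∧ IsTrack k (Finset.univ.image g) := by
  intro g
  have hsum : ∀ y : Option (Fin n) → F, ∑ o, y o • g o =
      y none • (Hmat k P *ᵥ v) + Hmat k P *ᵥ fun i => y (some i) := by
    intro y
    rw [Fintype.sum_option, mulVec_Hmat _ _ fun i => y (some i)]
    rfl
  have hnorm : ∀ y : Option (Fin n) → F, hammingNorm y =
      (if y none ≠ 0 then 1 else 0) + hammingNorm fun i => y (some i) := by
    intro y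
    simp only [hammingNorm, Finset.card_filter, Fintype.sum_option]
  refine isTrack_of_relations hk g (fun y hy hrel => ?_) ?_
  · rw [hsum] at hrel
    rw [hnorm]
    by_cases h0 : y none = 0
    · simp only [h0, zero_smul, zero_add] at hrel
      have hne : (fun i => y (some i)) ≠ 0 := by
        intro h
        refine hy (funext fun o => ?_)
        cases o with
        | none => exact h0
        | some i => exact congrFun h i
      have : minDist (resCode k P) ≤ hammingNorm fun i => y (some i) :=
        Nat.sInf_le ⟨_, ⟨hrel, hne⟩, hammingDist_zero_right _⟩
      omega
    · have hle : dTo v (resCode k P) ≤ hammingNorm ((-(y none)⁻¹) • fun i => y (some i)) := by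
        refine dTo_le ?_
        rw [Matrix.mulVec_smul, eq_neg_of_add_eq_zero_right hrel, smul_neg, neg_smul, neg_neg,
          smul_smul, inv_mul_cancel₀ h0, one_smul]
      have := hammingNorm_smul (k := -(y none)⁻¹) (fun i => .of_ne_zero (by simpa using h0))
        (fun i => y (some i))
      simp only [ne_eq, h0, not_false_eq_true, if_true]
      omega
  · obtain ⟨c, ⟨hc, -⟩, hck⟩ := Nat.sInf_mem
      (s := (fun c => hammingDist c 0) '' (resCode k P \ {0}))
      (Nat.nonempty_of_pos_sInf (by change 0 < minDist _; omega))
    refine ⟨fun o => o.elim 0 c, ?_, ?_⟩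
    · rw [hnorm]
      simp only [Option.elim_none, Option.elim_some, ne_eq, not_true_eq_false, if_false, zero_add]
      rw [← hammingDist_zero_right, ← hd]
      exact hck
    · rw [hsum]
      simp only [Option.elim_none, Option.elim_some, zero_smul, zero_add]
      exact hc

end EllipticArc

/-- **Corollary 4.12.** Let `ε = {φ_k(Q) : Q ∈ E(F_q)}`. Suppose there is
`N_0 ≤ n` such that every track having at least `N_0` of its points proportional to vectors
of `ε` consists entirely of points proportional to vectors of `ε`, and suppose
`C = C_Ω(D,kO)` is near-MDS (`d(C) = k`) with covering radius `k−1`. Then `v` is a deep hole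
of `C` iff `H(k)vᵀ = c·φ_k(Q)` for some rational point `Q ∈ E(F_q) ∖ D` (possibly `Q = O`)
and some nonzero `c ∈ F_q`. -/
theorem completeness_of_deep_holes
    (F : Type) [Field F] [Fintype F] [DecidableEq F]
    (hq : Odd (Fintype.card F))
    (s t : F) (hdisc : 4 * s ^ 3 + 27 * t ^ 2 ≠ 0)
    {n : ℕ} (k : ℕ) (P : Fin n → F × F)
    (hPinj : Function.Injective P)
    (hPcurve : ∀ i, onCurve s t (P i))
    (hk2 : 2 ≤ k) (hkn : k ≤ n - 2)
    (eps : Set (Fin k → F))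
    (heps : eps = insert (phiInf F k) {w | ∃ Q : F × F, onCurve s t Q ∧ w = phiAff k Q})
    (N0 : ℕ) (hN0n : N0 ≤ n)
    (hN0 : ∀ T : Finset (Fin k → F), IsTrack k T →
      N0 ≤ ((T : Set (Fin k → F)) ∩
        {w | ∃ c : F, c ≠ 0 ∧ ∃ u ∈ eps, w = c • u}).ncard →
      (T : Set (Fin k → F)) ⊆ {w | ∃ c : F, c ≠ 0 ∧ ∃ u ∈ eps, w = c • u})
    (hd : minDist (resCode k P) = k)
    (hρ : covRad (resCode k P) = k - 1)
    (v : Fin n → F) :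
    dTo v (resCode k P) = covRad (resCode k P) ↔
      ∃ c : F, c ≠ 0 ∧
        (Matrix.mulVec (Hmat k P) v = c • phiInf F k ∨
          ∃ Q : F × F, onCurve s t Q ∧ Q ∉ Set.range P ∧
            Matrix.mulVec (Hmat k P) v = c • phiAff k Q) := by
  have hk3 : 3 ≤ k := by
    by_contra! hlt
    obtain rfl : k = 2 := by omega
    have := EllipticArc.one_lt_covRad_two hPinj hPcurve (by omega)
    omega
  constructor
  · intro hv
    obtain ⟨hinj, hT⟩ := EllipticArc.isTrack_insert_syndrome hk3 hd (hv.trans hρ).ge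
    set g : Option (Fin n) → Fin k → F :=
      fun o => o.elim (Hmat k P *ᵥ v) fun i => phiAff k (P i) with hg
    have hcount : N0 ≤ (((Finset.univ.image g : Finset (Fin k → F)) : Set (Fin k → F)) ∩
        {w | ∃ c : F, c ≠ 0 ∧ ∃ u ∈ eps, w = c • u}).ncard := by
      have hsub : Set.range (fun i => g (some i)) ⊆
          ((Finset.univ.image g : Finset (Fin k → F)) : Set (Fin k → F)) ∩
          {w | ∃ c : F, c ≠ 0 ∧ ∃ u ∈ eps, w = c • u} := by
        rintro _ ⟨i, rfl⟩
        refine ⟨by simp, 1, one_ne_zero, phiAff k (P i), ?_, by simp [hg]⟩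
        rw [heps]
        exact Or.inr ⟨P i, hPcurve i, rfl⟩
      refine le_trans ?_ (Set.ncard_le_ncard hsub (Set.toFinite _))
      rw [← Set.image_univ, Set.ncard_image_of_injective _
        (fun i j hij => Option.some_injective _ (hinj hij)), Set.ncard_univ]
      simpa using hN0n
    obtain ⟨c, hc, u, hu, hw⟩ := hN0 _ hT hcount
      (show g none ∈ ((Finset.univ.image g : Finset (Fin k → F)) : Set (Fin k → F)) by simp)
    change Hmat k P *ᵥ v = c • u at hw
    refine ⟨c, hc, ?_⟩
    rw [heps] at hu
    rcases hu with rfl | ⟨Q, hQ, rfl⟩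
    · exact Or.inl hw
    · refine Or.inr ⟨Q, hQ, ?_, hw⟩
      rintro ⟨i, rfl⟩
      have hle : dTo v (resCode k P) ≤ hammingNorm (Pi.single i c : Fin n → F) := by
        refine EllipticArc.dTo_le ?_
        rw [hw, EllipticArc.mulVec_Hmat, Finset.sum_eq_single i]
        · simp
        · intro j _ hj
          simp [hj]
        · simp
      have h1 : hammingNorm (Pi.single i c : Fin n → F) ≤ 1 := by
        refine (Finset.card_le_card (t := {i}) fun j hj => ?_).trans_eq (Finset.card_singleton i)
        by_contra hne
        simp_all
      omega
  · rintro ⟨c, hc, hw⟩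
    refine le_antisymm (EllipticArc.dTo_le_covRad _ _) ?_
    obtain ⟨x, hx, hxn⟩ := EllipticArc.exists_hammingNorm_eq_dTo k P v
    rw [hρ, ← hxn]
    refine EllipticArc.le_hammingNorm_of_separating hPinj hk2 hkn (fun J hJ => ?_) hx
    have hJc : ∀ p ∈ J.image P, onCurve s t p := by
      intro p hp
      obtain ⟨i, -, rfl⟩ := Finset.mem_image.1 hp
      exact hPcurve i
    rcases hw with hw | ⟨Q, hQ, hQP, hw⟩
    · obtain ⟨u, hu, hne⟩ := EllipticArc.exists_separating_infinity hk3 hJc hJ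
      exact ⟨u, hu, by simpa [hw, dotProduct_smul] using ⟨hc, hne⟩⟩
    · obtain ⟨u, hu, hne⟩ := EllipticArc.exists_separating_affine hJc hJ hQ fun h => by
        obtain ⟨i, -, hi⟩ := Finset.mem_image.1 h
        exact hQP ⟨i, hi⟩
      exact ⟨u, hu, by simpa [hw, dotProduct_smul] using ⟨hc, hne⟩⟩
end

section
/- Let k ≥ 2 and let P_1,…,P_m be distinct affine rational points of E with m ≤ k−1. Then the vectors φ_k(P_1),…,φ_k(P_m) ∈ F_q^k are linearly independent over F_q. (Equivalently, any k−1 columns of the parity-check matrix H(k) are linearly independent, so the residue elliptic code C_Ω(D,kO) has minimum distance at least k.) -/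
open Matrix BigOperators

/-- The monomial `x ^ i * y ^ j` with `j ≤ 1` and pole order `2 * i + 3 * j = n` at infinity,
evaluated at `P`; there is none for `n = 1`, where the value is `0`. -/
def poleMonomial {F : Type*} [Field F] (n : ℕ) (P : F × F) : F :=
  if n = 1 then 0 else if n % 2 = 0 then P.1 ^ (n / 2) else P.2 * P.1 ^ ((n - 3) / 2)

section PoleMonomial

variable {F : Type*} [Field F]

@[simp]
lemma poleMonomial_one (P : F × F) : poleMonomial 1 P = 0 := by
  simp [poleMonomial]

lemma poleMonomial_two_mul (i : ℕ) (P : F × F) : poleMonomial (2 * i) P = P.1 ^ i := by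
  simp [poleMonomial]

lemma poleMonomial_two_mul_add_three (i : ℕ) (P : F × F) :
    poleMonomial (2 * i + 3) P = P.2 * P.1 ^ i := by
  simp [poleMonomial]

lemma eq_one_or_two_mul_or_two_mul_add_three (n : ℕ) :
    n = 1 ∨ (∃ i, n = 2 * i) ∨ ∃ i, n = 2 * i + 3 := by
  by_cases h : n = 1
  · exact Or.inl h
  · rcases Nat.even_or_odd' n with ⟨i, hi | hi⟩
    · exact Or.inr (Or.inl ⟨i, hi⟩)
    · exact Or.inr (Or.inr ⟨i - 1, by omega⟩)

lemma fst_mul_poleMonomial {n : ℕ} (hn : n ≠ 1) (P : F × F) :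
    P.1 * poleMonomial n P = poleMonomial (n + 2) P := by
  rcases eq_one_or_two_mul_or_two_mul_add_three n with rfl | ⟨i, rfl⟩ | ⟨i, rfl⟩
  · exact absurd rfl hn
  · rw [show 2 * i + 2 = 2 * (i + 1) by ring, poleMonomial_two_mul, poleMonomial_two_mul]
    ring
  · rw [show 2 * i + 3 + 2 = 2 * (i + 1) + 3 by ring, poleMonomial_two_mul_add_three,
      poleMonomial_two_mul_add_three]
    ring

variable {ι : Type*} (P : ι → F × F)

/-- The evaluations at the points `P i` of the functions of pole order less than `n`. -/
def poleSpan (n : ℕ) : Submodule F (ι → F) :=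
  Submodule.span F ((fun j i => poleMonomial j (P i)) '' Set.Iio n)

variable {P}

lemma poleSpan_mono {a b : ℕ} (h : a ≤ b) : poleSpan P a ≤ poleSpan P b :=
  Submodule.span_mono (Set.image_mono (Set.Iio_subset_Iio h))

lemma poleMonomial_mem_poleSpan {j n : ℕ} (h : j < n) :
    (fun i => poleMonomial j (P i)) ∈ poleSpan P n :=
  Submodule.subset_span ⟨j, h, rfl⟩

lemma mul_mem_of_mem_poleSpan {n : ℕ} {U : Submodule F (ι → F)} {g w : ι → F}
    (h : ∀ j < n, (g * fun i => poleMonomial j (P i)) ∈ U) (hw : w ∈ poleSpan P n) :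
    g * w ∈ U := by
  have hle : poleSpan P n ≤ U.comap (LinearMap.mulLeft F g) := by
    refine Submodule.span_le.2 ?_
    rintro _ ⟨j, hj, rfl⟩
    exact h j hj
  exact hle hw

lemma fst_mul_mem_poleSpan {n : ℕ} {w : ι → F} (hw : w ∈ poleSpan P n) :
    (fun i => (P i).1) * w ∈ poleSpan P (n + 2) := by
  refine mul_mem_of_mem_poleSpan (fun j hj => ?_) hw
  by_cases h : j = 1
  · subst h
    convert (poleSpan P (n + 2)).zero_mem using 1
    ext i
    simp
  · convert poleMonomial_mem_poleSpan (P := P) (show j + 2 < n + 2 by omega) using 1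
    ext i
    exact fst_mul_poleMonomial h (P i)

lemma snd_mul_poleMonomial_sub_mem_poleSpan {s t : F} (hP : ∀ i, onCurve s t (P i)) {n : ℕ}
    (hn : n ≠ 1) :
    ((fun i => (P i).2) * (fun i => poleMonomial n (P i)) - fun i => poleMonomial (n + 3) (P i))
      ∈ poleSpan P (n + 3) := by
  rcases eq_one_or_two_mul_or_two_mul_add_three n with rfl | ⟨i, rfl⟩ | ⟨i, rfl⟩
  · exact absurd rfl hn
  · convert (poleSpan P (2 * i + 3)).zero_mem using 1
    ext l
    simp [poleMonomial_two_mul, poleMonomial_two_mul_add_three]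
  · convert (poleSpan P (2 * i + 3 + 3)).add_mem
      ((poleSpan P (2 * i + 3 + 3)).smul_mem s
        (poleMonomial_mem_poleSpan (P := P) (show 2 * (i + 1) < 2 * i + 3 + 3 by omega)))
      ((poleSpan P (2 * i + 3 + 3)).smul_mem t
        (poleMonomial_mem_poleSpan (P := P) (show 2 * i < 2 * i + 3 + 3 by omega))) using 1
    ext l
    have h : (P l).2 ^ 2 = (P l).1 ^ 3 + s * (P l).1 + t := hP l
    simp only [Pi.sub_apply, Pi.mul_apply, Pi.add_apply, Pi.smul_apply, smul_eq_mul,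
      show 2 * i + 3 + 3 = 2 * (i + 3) by ring, poleMonomial_two_mul,
      poleMonomial_two_mul_add_three]
    linear_combination (P l).1 ^ i * h

lemma snd_mul_mem_poleSpan {s t : F} (hP : ∀ i, onCurve s t (P i)) {n : ℕ} {w : ι → F}
    (hw : w ∈ poleSpan P n) : (fun i => (P i).2) * w ∈ poleSpan P (n + 3) := by
  refine mul_mem_of_mem_poleSpan (fun j hj => ?_) hw
  by_cases h : j = 1
  · subst h
    convert (poleSpan P (n + 3)).zero_mem using 1
    ext i
    simp
  · exact (Submodule.sub_mem_iff_left _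
      (poleMonomial_mem_poleSpan (show j + 3 < n + 3 by omega))).1
      (poleSpan_mono (by omega) (snd_mul_poleMonomial_sub_mem_poleSpan hP h))

/-- Once a pole order `a` is redundant, so is every pole order from `a + 2` on. -/
lemma poleMonomial_mem_poleSpan_add_two {s t : F} (hP : ∀ i, onCurve s t (P i)) {a : ℕ}
    (ha : a ≠ 1) (h : (fun i => poleMonomial a (P i)) ∈ poleSpan P a) (n : ℕ) :
    (fun i => poleMonomial n (P i)) ∈ poleSpan P (a + 2) := by
  have hx : ∀ b, b ≠ 1 → (fun i => poleMonomial b (P i)) ∈ poleSpan P b →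
      (fun i => poleMonomial (b + 2) (P i)) ∈ poleSpan P (b + 2) := by
    intro b hb hmem
    convert fst_mul_mem_poleSpan hmem using 1
    ext i
    exact (fst_mul_poleMonomial hb (P i)).symm
  have hy : (fun i => poleMonomial (a + 3) (P i)) ∈ poleSpan P (a + 3) :=
    (Submodule.sub_mem_iff_right _ (snd_mul_mem_poleSpan hP h)).1
      (snd_mul_poleMonomial_sub_mem_poleSpan hP ha)
  have hall : ∀ d, (fun i => poleMonomial (a + 2 + d) (P i)) ∈ poleSpan P (a + 2 + d) := by
    intro d
    induction d using Nat.strong_induction_on with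
    | _ d ih =>
      match d with
      | 0 => exact hx a ha h
      | 1 => exact hy
      | d + 2 => exact hx (a + 2 + d) (by omega) (ih d (by omega))
  have hle : ∀ d, poleSpan P (a + 2 + d) ≤ poleSpan P (a + 2) := by
    intro d
    induction d with
    | zero => exact le_rfl
    | succ d ih =>
      refine Submodule.span_le.2 ?_
      rintro _ ⟨j, hj, rfl⟩
      rcases Nat.lt_succ_iff_lt_or_eq.1 (show j < a + 2 + d + 1 from hj) with hj | rfl
      · exact ih (poleMonomial_mem_poleSpan hj)
      · exact ih (hall d)
  exact hle (n + 1) (poleMonomial_mem_poleSpan (by omega))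

/-- A space of functions on finitely many distinct points of the plane which contains `1` and is
stable under multiplication by the coordinates contains all functions. -/
lemma eq_top_of_mul_coord_mem [Fintype ι] (hP : Function.Injective P)
    {U : Submodule F (ι → F)} (h1 : (1 : ι → F) ∈ U)
    (hx : ∀ w ∈ U, (fun i => (P i).1) * w ∈ U) (hy : ∀ w ∈ U, (fun i => (P i).2) * w ∈ U) :
    U = ⊤ := by
  classical
  have key : ∀ (i : ι) (s : Finset ι), i ∉ s → ∃ g ∈ U, g i ≠ 0 ∧ ∀ j ∈ s, g j = 0 := by
    intro i s
    induction s using Finset.induction_on with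
    | empty => exact fun _ => ⟨1, h1, by simp, by simp⟩
    | insert j s _ ih =>
      intro his
      rw [Finset.mem_insert, not_or] at his
      obtain ⟨g, hg, hgi, hgs⟩ := ih his.2
      have hne : (P i).1 ≠ (P j).1 ∨ (P i).2 ≠ (P j).2 := by
        by_contra! h
        exact his.1 (hP (Prod.ext h.1 h.2))
      rcases hne with hne | hne
      · refine ⟨(fun l => (P l).1) * g - (P j).1 • g, U.sub_mem (hx g hg) (U.smul_mem _ hg), ?_, ?_⟩
        · simpa [← sub_mul, sub_eq_zero, hgi] using hne
        · intro l hl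
          rcases Finset.mem_insert.1 hl with rfl | hl
          · simp
          · simp [hgs l hl]
      · refine ⟨(fun l => (P l).2) * g - (P j).2 • g, U.sub_mem (hy g hg) (U.smul_mem _ hg), ?_, ?_⟩
        · simpa [← sub_mul, sub_eq_zero, hgi] using hne
        · intro l hl
          rcases Finset.mem_insert.1 hl with rfl | hl
          · simp
          · simp [hgs l hl]
  rw [eq_top_iff, ← (Pi.basisFun F ι).span_eq, Submodule.span_le]
  rintro _ ⟨i, rfl⟩
  obtain ⟨g, hg, hgi, hgs⟩ := key i (Finset.univ.erase i) (by simp)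
  have hsingle : Pi.basisFun F ι i = (g i)⁻¹ • g := by
    ext j
    by_cases hj : j = i
    · subst hj
      simp [hgi]
    · simp [hj, hgs j (by simp [hj])]
  exact hsingle ▸ U.smul_mem _ hg

lemma poleSpan_add_two_eq_top [Fintype ι] (hinj : Function.Injective P) {s t : F}
    (hP : ∀ i, onCurve s t (P i)) {a : ℕ} (ha : a ≠ 1)
    (h : (fun i => poleMonomial a (P i)) ∈ poleSpan P a) : poleSpan P (a + 2) = ⊤ := by
  have hle : ∀ n, poleSpan P n ≤ poleSpan P (a + 2) := by
    intro n
    refine Submodule.span_le.2 ?_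
    rintro _ ⟨j, -, rfl⟩
    exact poleMonomial_mem_poleSpan_add_two hP ha h j
  refine eq_top_of_mul_coord_mem hinj ?_ (fun w hw => hle _ (fst_mul_mem_poleSpan hw))
    (fun w hw => hle _ (snd_mul_mem_poleSpan hP hw))
  convert poleMonomial_mem_poleSpan (P := P) (show 2 * 0 < a + 2 by omega) using 1
  ext i
  simp [poleMonomial]

/-- Functions of pole order at most `m + 1` interpolate arbitrary values at `m` distinct points. -/
lemma poleSpan_card_add_two_eq_top [Fintype ι] (hinj : Function.Injective P) {s t : F}
    (hP : ∀ i, onCurve s t (P i)) : poleSpan P (Fintype.card ι + 2) = ⊤ := by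
  rcases isEmpty_or_nonempty ι with hι | hι
  · exact Subsingleton.elim _ _
  by_cases hex : ∃ a, 2 ≤ a ∧ a ≤ Fintype.card ι ∧
      (fun i => poleMonomial a (P i)) ∈ poleSpan P a
  · obtain ⟨a, ha, ham, hmem⟩ := hex
    exact top_le_iff.1 ((poleSpan_add_two_eq_top hinj hP (by omega) hmem).ge.trans
      (poleSpan_mono (by omega)))
  · push Not at hex
    have hrank : ∀ d, d + 1 ≤ Fintype.card ι → d + 1 ≤ Module.finrank F (poleSpan P (d + 2)) := by
      intro d
      induction d with
      | zero =>
        intro _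
        refine Submodule.one_le_finrank_iff.2 fun hbot => ?_
        have h := poleMonomial_mem_poleSpan (P := P) (show 0 < 0 + 2 by omega)
        rw [hbot, Submodule.mem_bot] at h
        simpa [poleMonomial] using congrFun h hι.some
      | succ d ih =>
        intro hd
        have hlt : poleSpan P (d + 2) < poleSpan P (d + 1 + 2) :=
          SetLike.lt_iff_le_and_exists.2 ⟨poleSpan_mono (by omega), _,
            poleMonomial_mem_poleSpan (show d + 2 < d + 1 + 2 by omega),
            hex (d + 2) (by omega) (by omega)⟩
        have := Submodule.finrank_lt_finrank_of_lt hlt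
        have := ih (by omega)
        omega
    have hpos : 0 < Fintype.card ι := Fintype.card_pos
    have h := hrank (Fintype.card ι - 1) (by omega)
    have htop : poleSpan P (Fintype.card ι - 1 + 2) = ⊤ := by
      refine Submodule.eq_top_of_finrank_eq (le_antisymm (Submodule.finrank_le _) ?_)
      rw [Module.finrank_fintype_fun_eq_card]
      omega
    exact top_le_iff.1 (htop.ge.trans (poleSpan_mono (by omega)))

lemma exists_phiAff_eq_poleMonomial {k n : ℕ} (hk : 2 ≤ k) (hn : n ≤ k) (hn1 : n ≠ 1) :
    ∃ j : Fin k, ∀ Q : F × F, phiAff k Q j = poleMonomial n Q := by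
  rcases eq_one_or_two_mul_or_two_mul_add_three n with rfl | ⟨i, rfl⟩ | ⟨i, rfl⟩
  · exact absurd rfl hn1
  · refine ⟨⟨i, by omega⟩, fun Q => ?_⟩
    rw [poleMonomial_two_mul]
    exact if_pos (show i ≤ k / 2 by omega)
  · refine ⟨⟨k / 2 + 1 + i, by omega⟩, fun Q => ?_⟩
    have h1 : ¬ k / 2 + 1 + i ≤ k / 2 := by omega
    have h2 : k / 2 + 1 + i - k / 2 - 1 = i := by omega
    simp only [phiAff, h1, if_false, h2, poleMonomial_two_mul_add_three]

end PoleMonomial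

/-- For `k ≥ 2` and distinct affine rational points `P_1, …, P_m` of `E`
with `m ≤ k−1`, the vectors `φ_k(P_1), …, φ_k(P_m) ∈ F_q^k` are linearly independent. -/
theorem phi_of_distinct_points_linearIndependent
    (F : Type) [Field F] [Fintype F] [DecidableEq F]
    (hq : Odd (Fintype.card F))
    (s t : F) (hdisc : 4 * s ^ 3 + 27 * t ^ 2 ≠ 0)
    (k m : ℕ) (hk : 2 ≤ k) (hm : m ≤ k - 1)
    (P : Fin m → F × F)
    (hPinj : Function.Injective P)
    (hPcurve : ∀ i, onCurve s t (P i)) :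
    LinearIndependent F (fun i : Fin m => phiAff k (P i)) := by
  rw [Fintype.linearIndependent_iff]
  intro c hc i
  have hle : poleSpan P (m + 2) ≤ LinearMap.ker (Fintype.linearCombination F c) := by
    refine Submodule.span_le.2 ?_
    rintro _ ⟨n, hn, rfl⟩
    have hn : n < m + 2 := hn
    rw [SetLike.mem_coe, LinearMap.mem_ker, Fintype.linearCombination_apply]
    by_cases h1 : n = 1
    · simp [h1]
    · obtain ⟨j, hj⟩ := exists_phiAff_eq_poleMonomial (F := F) hk (show n ≤ k by omega) h1
      simpa [hj, mul_comm] using congrFun hc j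
  have htop : poleSpan P (m + 2) = ⊤ := by
    simpa using poleSpan_card_add_two_eq_top hPinj hPcurve
  have hmem : Pi.single i (1 : F) ∈ poleSpan P (m + 2) := htop ▸ Submodule.mem_top
  simpa using hle hmem
end
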